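/- arXiv:1407.8282 — 3 statements merged into one kernel-verified Lean document; each statement's English description precedes it below -/
import Mathlib

section
/- Let t ≥ 1 and let p(z) = Σ_{ℓ=1}^{t} a_ℓ P_ℓ^{(d)}(z) with a_ℓ > 0 for every ℓ = 1, ..., t. Then for every finite set X_N ⊂ S^d of N points, the energy functional E_p(X_N) = Σ_{(x,y) ∈ X_N × X_N} p(⟨x, y⟩) is nonnegative, and E_p(X_N) = 0 if and only if X_N is a spherical t-design. -/
open MeasureTheory
open scoped RealInnerProductSpace

/-- The normalised surface area measure `σ_d` on the unit sphere `S^d ⊂ ℝ^{d+1}`. -/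
noncomputable def sphereMeasure (d : ℕ) :
    Measure (EuclideanSpace ℝ (Fin (d + 1))) :=
  (μH[(d : ℝ)] (Metric.sphere (0 : EuclideanSpace ℝ (Fin (d + 1))) 1))⁻¹ •
    (μH[(d : ℝ)]).restrict (Metric.sphere (0 : EuclideanSpace ℝ (Fin (d + 1))) 1)

/-- A finite set `X ⊂ S^d` is a spherical `t`-design if the equal-weight average over `X`
of every polynomial of total degree at most `t` equals its integral over `S^d`. -/
def IsSphericalDesign (d t : ℕ) (X : Finset (EuclideanSpace ℝ (Fin (d + 1)))) : Prop :=
  ∀ p : MvPolynomial (Fin (d + 1)) ℝ, p.totalDegree ≤ t →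
    (X.card : ℝ)⁻¹ * ∑ x ∈ X, MvPolynomial.eval (fun i => x i) p =
      ∫ y, MvPolynomial.eval (fun i => y i) p ∂(sphereMeasure d)

/-- The Legendre polynomial `P_ℓ^{(d)}` for the sphere `S^d`, normalised so that
`P_ℓ^{(d)}(1) = 1`. -/
noncomputable def legendreP (d : ℕ) : ℕ → ℝ → ℝ
  | 0 => fun _ => 1
  | 1 => fun x => x
  | n + 2 => fun x =>
      ((2 * (n : ℝ) + d + 1) * x * legendreP d (n + 1) x - ((n : ℝ) + 1) * legendreP d n x)
        / ((n : ℝ) + d)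



lemma hausdorff_pi (d : ℕ) : (μH[(d:ℝ)] : Measure (Fin d → ℝ)) = volume := by
  have := @hausdorffMeasure_pi_real (Fin d) _
  simpa using this

lemma sphere_ne_zero (d : ℕ) :
    μH[(d : ℝ)] (Metric.sphere (0 : EuclideanSpace ℝ (Fin (d + 1))) 1) ≠ 0 := by
  intro h0
  let f : (EuclideanSpace ℝ (Fin (d + 1))) → (Fin d → ℝ) := fun x j => x (Fin.succ j)
  have hf : LipschitzWith 1 f := by
    refine LipschitzWith.of_dist_le_mul fun x y => ?_
    rw [NNReal.coe_one, one_mul, dist_pi_le_iff dist_nonneg]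
    intro j
    rw [dist_eq_norm, dist_eq_norm]
    exact PiLp.norm_apply_le (x - y) (Fin.succ j)
  have h1 := hf.hausdorffMeasure_image_le (d := (d:ℝ)) (by positivity)
    (Metric.sphere (0 : EuclideanSpace ℝ (Fin (d + 1))) 1)
  rw [h0, mul_zero, hausdorff_pi] at h1
  let U : Set (Fin d → ℝ) := {v | ∑ j, v j ^ 2 < 1}
  have hU : IsOpen U := isOpen_lt (by fun_prop) continuous_const
  have hUpos : 0 < volume U := hU.measure_pos _ ⟨0, by simp [U]⟩
  have hsub : U ⊆ f '' (Metric.sphere (0 : EuclideanSpace ℝ (Fin (d + 1))) 1) := by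
    intro v hv
    have hv' : ∑ j, v j ^ 2 < 1 := hv
    refine ⟨WithLp.toLp 2 (Fin.cons (Real.sqrt (1 - ∑ j, v j ^ 2)) v), ?_, ?_⟩
    · rw [mem_sphere_zero_iff_norm, EuclideanSpace.norm_eq, Fin.sum_univ_succ]
      simp only [Fin.cons_zero, Fin.cons_succ, Real.norm_eq_abs, sq_abs]
      rw [Real.sq_sqrt (by linarith)]
      simp
    · ext j; simp [f]
  have := (measure_mono hsub).trans h1
  exact absurd hUpos (by simpa using this)

lemma sphere_ne_top (d : ℕ) :
    μH[(d : ℝ)] (Metric.sphere (0 : EuclideanSpace ℝ (Fin (d + 1))) 1) ≠ ⊤ := by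
  let g : Fin (d+1) → ℝ → (Fin d → ℝ) → EuclideanSpace ℝ (Fin (d + 1)) :=
    fun i e v => WithLp.toLp 2 (i.insertNth e v)
  let f : Fin (d+1) → ℝ → (Fin d → ℝ) → EuclideanSpace ℝ (Fin (d + 1)) :=
    fun i e v => (‖g i e v‖)⁻¹ • g i e v
  have hfin : ∀ i : Fin (d+1), ∀ e : ℝ, e ≠ 0 →
      μH[(d:ℝ)] (f i e '' (Metric.closedBall 0 1)) < ⊤ := by
    intro i e he
    have hg : ContDiff ℝ 1 (g i e) := by
      rw [contDiff_euclidean]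
      intro j
      refine i.succAboveCases ?_ ?_ j
      · simp only [g, Fin.insertNth_apply_same]; fun_prop
      · intro k; simp only [g, Fin.insertNth_apply_succAbove]; fun_prop
    have hg0 : ∀ v, g i e v ≠ 0 := by
      intro v h
      have := congrArg (fun x : EuclideanSpace ℝ (Fin (d + 1)) => x i) h
      simp [g] at this
      exact he this
    have hf : ContDiff ℝ 1 (f i e) := by
      refine ContDiff.smul (ContDiff.inv (hg.norm ℝ hg0) ?_) hg
      intro v; simpa using hg0 v
    obtain ⟨K, hK⟩ := hf.locallyLipschitz.locallyLipschitzOn.exists_lipschitzOnWith_of_compact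
      (isCompact_closedBall (0 : Fin d → ℝ) 1)
    refine lt_of_le_of_lt (hK.hausdorffMeasure_image_le (d := (d:ℝ)) (by positivity)) ?_
    rw [hausdorff_pi]
    refine ENNReal.mul_lt_top ?_ (isCompact_closedBall _ _).measure_lt_top
    exact ENNReal.rpow_lt_top_of_nonneg (by positivity) ENNReal.coe_ne_top
  have hcov : Metric.sphere (0 : EuclideanSpace ℝ (Fin (d + 1))) 1 ⊆
      ⋃ i : Fin (d+1), (f i 1 '' (Metric.closedBall 0 1) ∪ f i (-1) '' (Metric.closedBall 0 1)) := by
    intro x hx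
    rw [mem_sphere_zero_iff_norm] at hx
    obtain ⟨i, hi⟩ := Finite.exists_max (fun i => |x i|)
    have hxi : x i ≠ 0 := by
      intro h
      have : x = 0 := by
        ext j
        have := hi j
        simp [h] at this
        simpa using this
      simp [this] at hx
    have hpos : 0 < |x i| := abs_pos.2 hxi
    let v : Fin d → ℝ := fun j => |x i|⁻¹ * x (i.succAbove j)
    have hv : v ∈ Metric.closedBall (0 : Fin d → ℝ) 1 := by
      rw [mem_closedBall_zero_iff, pi_norm_le_iff_of_nonneg zero_le_one]
      intro j
      simp only [v, norm_mul, norm_inv, Real.norm_eq_abs, abs_abs]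
      rw [inv_mul_le_iff₀ hpos, mul_one]
      exact hi _
    have hgv : g i (|x i|⁻¹ * x i) v = |x i|⁻¹ • x := by
      ext j
      refine i.succAboveCases ?_ ?_ j
      · simp [g]
      · intro k; simp [g, v]
    have hfv : f i (|x i|⁻¹ * x i) v = x := by
      simp only [f, hgv, norm_smul, hx, norm_inv, Real.norm_eq_abs, abs_abs, mul_one, inv_inv]
      rw [smul_smul, mul_inv_cancel₀ hpos.ne', one_smul]
    rw [Set.mem_iUnion]
    refine ⟨i, ?_⟩
    rcases lt_or_gt_of_ne hxi with h | h
    · right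
      refine ⟨v, hv, ?_⟩
      rw [← hfv]; congr 1
      rw [abs_of_neg h]; field_simp
    · left
      refine ⟨v, hv, ?_⟩
      rw [← hfv]; congr 1
      rw [abs_of_pos h]; field_simp
  refine ne_of_lt (lt_of_le_of_lt (measure_mono hcov) ?_)
  refine lt_of_le_of_lt (measure_iUnion_le _) ?_
  rw [tsum_fintype]
  refine ENNReal.sum_lt_top.2 fun i _ => ?_
  exact lt_of_le_of_lt (measure_union_le _ _)
    (ENNReal.add_lt_top.2 ⟨hfin i 1 one_ne_zero, hfin i (-1) (by norm_num)⟩)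

instance sphereMeasure_prob (d : ℕ) : IsProbabilityMeasure (sphereMeasure d) := by
  constructor
  rw [sphereMeasure, Measure.smul_apply, Measure.restrict_apply_univ, smul_eq_mul]
  exact ENNReal.inv_mul_cancel (sphere_ne_zero d) (sphere_ne_top d)

lemma sphereMeasure_ae (d : ℕ) : ∀ᵐ y ∂(sphereMeasure d), ‖y‖ = 1 := by
  refine Measure.ae_smul_measure ?_ _
  filter_upwards [ae_restrict_mem Metric.isClosed_sphere.measurableSet] with y hy
  simpa using hy

lemma sphereMeasure_map (d : ℕ) (e : EuclideanSpace ℝ (Fin (d + 1)) ≃ₗᵢ[ℝ] EuclideanSpace ℝ (Fin (d + 1))) :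
    MeasurePreserving e (sphereMeasure d) (sphereMeasure d) := by
  refine MeasurePreserving.smul_measure ?_ _
  have h := (e.toIsometryEquiv.measurePreserving_hausdorffMeasure (d:ℝ)).restrict_preimage
    (s := Metric.sphere (0 : EuclideanSpace ℝ (Fin (d + 1))) 1) Metric.isClosed_sphere.measurableSet
  have h2 : (e.toIsometryEquiv ⁻¹' Metric.sphere (0 : EuclideanSpace ℝ (Fin (d + 1))) 1)
      = Metric.sphere (0 : EuclideanSpace ℝ (Fin (d + 1))) 1 := by
    ext x; simp
  rw [h2] at h
  exact h

lemma poly_integrable (d : ℕ) (p : MvPolynomial (Fin (d+1)) ℝ) :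
    Integrable (fun y : EuclideanSpace ℝ (Fin (d + 1)) => MvPolynomial.eval (fun i => y i) p)
      (sphereMeasure d) := by
  have hc : Continuous (fun y : EuclideanSpace ℝ (Fin (d + 1)) =>
      MvPolynomial.eval (fun i => y i) p) :=
    (MvPolynomial.continuous_eval p).comp (by fun_prop)
  obtain ⟨C, hC⟩ := (isCompact_sphere (0 : EuclideanSpace ℝ (Fin (d + 1))) 1).exists_bound_of_continuousOn
    hc.continuousOn
  refine Integrable.of_bound hc.aestronglyMeasurable C ?_
  filter_upwards [sphereMeasure_ae d] with y hy
  exact hC y (by simpa using hy)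

/-- Integration over the sphere as a linear functional. -/
noncomputable def sphLam (d : ℕ) : MvPolynomial (Fin (d+1)) ℝ →ₗ[ℝ] ℝ where
  toFun p := ∫ y, MvPolynomial.eval (fun i => y i) p ∂(sphereMeasure d)
  map_add' p q := by
    simp only [map_add]
    exact integral_add (poly_integrable d p) (poly_integrable d q)
  map_smul' c p := by
    simp only [MvPolynomial.smul_eval, RingHom.id_apply, smul_eq_mul]
    exact integral_const_mul _ _

open MvPolynomial in
/-- The linear form `⟨x, ·⟩` as a polynomial. -/
noncomputable def linF {d : ℕ} (x : EuclideanSpace ℝ (Fin (d + 1))) : MvPolynomial (Fin (d+1)) ℝ :=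
  ∑ i, C (x i) * X i

open MvPolynomial in
/-- The squared norm as a polynomial. -/
noncomputable def sqF (d : ℕ) : MvPolynomial (Fin (d+1)) ℝ := ∑ i, X i ^ 2

open MvPolynomial in
/-- The Laplacian. -/
noncomputable def lapF {d : ℕ} (p : MvPolynomial (Fin (d+1)) ℝ) : MvPolynomial (Fin (d+1)) ℝ :=
  ∑ i, pderiv i (pderiv i p)

open MvPolynomial in
/-- Directional derivative. -/
noncomputable def dirD {d : ℕ} (x : EuclideanSpace ℝ (Fin (d + 1)))
    (p : MvPolynomial (Fin (d+1)) ℝ) : MvPolynomial (Fin (d+1)) ℝ :=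
  ∑ i, C (x i) * pderiv i p

open MvPolynomial in
/-- Zonal solid harmonic with pole `x`. -/
noncomputable def zon {d : ℕ} (x : EuclideanSpace ℝ (Fin (d + 1))) : ℕ → MvPolynomial (Fin (d+1)) ℝ
  | 0 => 1
  | 1 => linF x
  | n + 2 => C ((2 * (n : ℝ) + d + 1) / ((n : ℝ) + d)) * (linF x * zon x (n + 1))
      - C (((n : ℝ) + 1) / ((n : ℝ) + d)) * (sqF d * zon x n)

section alg
open MvPolynomial

variable {d : ℕ} (x : EuclideanSpace ℝ (Fin (d + 1)))

lemma eval_linF (y : EuclideanSpace ℝ (Fin (d + 1))) :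
    eval (fun i => y i) (linF x) = ⟪x, y⟫ := by
  simp [linF, PiLp.inner_apply, mul_comm]

lemma eval_sqF (y : EuclideanSpace ℝ (Fin (d + 1))) :
    eval (fun i => y i) (sqF d) = ‖y‖ ^ 2 := by
  simp [sqF, EuclideanSpace.norm_sq_eq]

lemma eval_zon (y : EuclideanSpace ℝ (Fin (d + 1))) (hy : ‖y‖ = 1) :
    ∀ n, eval (fun i => y i) (zon x n) = legendreP d n ⟪x, y⟫
  | 0 => by simp [zon, legendreP]
  | 1 => by simp [zon, legendreP, eval_linF]
  | n + 2 => by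
    rw [zon, legendreP]
    simp only [map_sub, map_mul, eval_C, eval_linF, eval_sqF, hy, eval_zon y hy (n+1), eval_zon y hy n]
    ring

lemma linF_hom : (linF x).IsHomogeneous 1 := by
  refine IsHomogeneous.sum _ _ _ fun i _ => ?_
  exact (isHomogeneous_X ℝ i).C_mul _

lemma sqF_hom : (sqF d).IsHomogeneous 2 := by
  refine IsHomogeneous.sum _ _ _ fun i _ => ?_
  exact isHomogeneous_X_pow i 2

lemma zon_hom : ∀ n, (zon x n).IsHomogeneous n
  | 0 => isHomogeneous_one _ _
  | 1 => linF_hom x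
  | n + 2 => by
    rw [zon]
    refine IsHomogeneous.sub ?_ ?_
    · refine IsHomogeneous.C_mul ?_ _
      have := (linF_hom x).mul (zon_hom (n+1))
      exact (show 1 + (n + 1) = n + 2 by omega) ▸ this
    · refine IsHomogeneous.C_mul ?_ _
      have := (sqF_hom (d := d)).mul (zon_hom n)
      exact (show 2 + n = n + 2 by omega) ▸ this

lemma zon_rec (hd : 1 ≤ d) (n : ℕ) :
    ((n : MvPolynomial (Fin (d+1)) ℝ) + d) * zon x (n+2) =
      (2 * n + d + 1) * (linF x * zon x (n+1)) - (n + 1) * (sqF d * zon x n) := by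
  have h : ((n:ℝ) + d) ≠ 0 := by positivity
  have e1 : ((n : MvPolynomial (Fin (d+1)) ℝ) + (d : MvPolynomial (Fin (d+1)) ℝ)) = (C ((n:ℝ) + d) : MvPolynomial (Fin (d+1)) ℝ) := by simp
  have e2 : (2 * (n : MvPolynomial (Fin (d+1)) ℝ) + (d : MvPolynomial (Fin (d+1)) ℝ) + 1) = (C (2 * (n:ℝ) + d + 1) : MvPolynomial (Fin (d+1)) ℝ) := by
    simp [map_ofNat]
  have e3 : ((n : MvPolynomial (Fin (d+1)) ℝ) + 1) = C ((n:ℝ) + 1) := by simp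
  have e4 : C (2 * (n:ℝ) + d + 1) = (C ((n:ℝ) + d) * C ((2 * (n : ℝ) + d + 1) / ((n : ℝ) + d)) :
      MvPolynomial (Fin (d+1)) ℝ) := by
    rw [← C_mul, mul_div_cancel₀ _ h]
  have e5 : C ((n:ℝ) + 1) = (C ((n:ℝ) + d) * C (((n : ℝ) + 1) / ((n : ℝ) + d)) :
      MvPolynomial (Fin (d+1)) ℝ) := by
    rw [← C_mul, mul_div_cancel₀ _ h]
  rw [zon, e1, e2, e3, e4, e5]
  ring

lemma pderiv_linF (i : Fin (d+1)) : pderiv i (linF x) = C (x i) := by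
  simp [linF, pderiv_X, Pi.single_apply]

lemma pderiv_sqF (i : Fin (d+1)) : pderiv i (sqF d) = 2 * X i := by
  simp [sqF, pderiv_X, Pi.single_apply]

lemma dirD_mul (p q : MvPolynomial (Fin (d+1)) ℝ) :
    dirD x (p * q) = p * dirD x q + q * dirD x p := by
  simp only [dirD, Finset.mul_sum, ← Finset.sum_add_distrib, pderiv_mul]
  exact Finset.sum_congr rfl fun i _ => by ring

lemma dirD_add (p q : MvPolynomial (Fin (d+1)) ℝ) :
    dirD x (p + q) = dirD x p + dirD x q := by
  simp only [dirD, ← Finset.sum_add_distrib, map_add, mul_add]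

lemma dirD_sub (p q : MvPolynomial (Fin (d+1)) ℝ) :
    dirD x (p - q) = dirD x p - dirD x q := by
  simp only [dirD, ← Finset.sum_sub_distrib, map_sub, mul_sub]

lemma dirD_C_mul (r : ℝ) (q : MvPolynomial (Fin (d+1)) ℝ) :
    dirD x (C r * q) = C r * dirD x q := by
  simp only [dirD, Finset.mul_sum, pderiv_C_mul]
  exact Finset.sum_congr rfl fun i _ => by ring

lemma dirD_linF (hx : ‖x‖ = 1) : dirD x (linF x) = 1 := by
  have h : ∑ i, x i * x i = 1 := by
    have := EuclideanSpace.norm_sq_eq x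
    rw [hx] at this
    simpa [pow_two] using this.symm
  simp only [dirD, pderiv_linF, ← C_mul, ← map_sum, h, C_1]

lemma dirD_sqF : dirD x (sqF d) = 2 * linF x := by
  simp only [dirD, pderiv_sqF, linF, Finset.mul_sum]
  exact Finset.sum_congr rfl fun i _ => by ring

lemma lapF_linF_mul (p : MvPolynomial (Fin (d+1)) ℝ) :
    lapF (linF x * p) = linF x * lapF p + 2 * dirD x p := by
  simp only [dirD, lapF, Finset.mul_sum, ← Finset.sum_add_distrib]
  refine Finset.sum_congr rfl fun i _ => ?_
  simp only [pderiv_mul, map_add, pderiv_linF, pderiv_C]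
  ring

lemma lapF_sqF_mul (p : MvPolynomial (Fin (d+1)) ℝ) (n : ℕ) (hp : p.IsHomogeneous n) :
    lapF (sqF d * p) = sqF d * lapF p + (4 * n + 2 * (d + 1)) * p := by
  have h := hp.sum_X_mul_pderiv
  have h2 : (4 * n + 2 * (d + 1)) * p = ∑ i : Fin (d+1), (4 * (X i * pderiv i p) + 2 * p) := by
    rw [Finset.sum_add_distrib, ← Finset.mul_sum, h]
    simp
    ring
  rw [h2]
  simp only [lapF, Finset.mul_sum, ← Finset.sum_add_distrib]
  refine Finset.sum_congr rfl fun i _ => ?_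
  have : pderiv i (2 : MvPolynomial (Fin (d+1)) ℝ) = 0 := by
    have := pderiv_C (σ := Fin (d+1)) (R := ℝ) (a := 2) (i := i)
    simpa [map_ofNat] using this
  simp only [pderiv_mul, map_add, pderiv_sqF, pderiv_X_self, this]
  ring

lemma lapF_sub (p q : MvPolynomial (Fin (d+1)) ℝ) :
    lapF (p - q) = lapF p - lapF q := by
  simp only [lapF, ← Finset.sum_sub_distrib, map_sub]

lemma lapF_C_mul (r : ℝ) (q : MvPolynomial (Fin (d+1)) ℝ) :
    lapF (C r * q) = C r * lapF q := by
  simp only [lapF, Finset.mul_sum, pderiv_C_mul]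

lemma nat_ne (hd : 1 ≤ d) (n : ℕ) : ((n : MvPolynomial (Fin (d+1)) ℝ) + d) ≠ 0 := by
  have : ((n + d : ℕ) : MvPolynomial (Fin (d+1)) ℝ) ≠ 0 := Nat.cast_ne_zero.2 (by omega)
  simpa using this

lemma castC (n : ℕ) : (n : MvPolynomial (Fin (d+1)) ℝ) = C (n:ℝ) := by simp

lemma dirD_natmul (n : ℕ) (q : MvPolynomial (Fin (d+1)) ℝ) :
    dirD x ((n : MvPolynomial (Fin (d+1)) ℝ) * q) = n * dirD x q := by
  rw [castC, dirD_C_mul]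

lemma lapF_natmul (n : ℕ) (q : MvPolynomial (Fin (d+1)) ℝ) :
    lapF ((n : MvPolynomial (Fin (d+1)) ℝ) * q) = n * lapF q := by
  rw [castC, lapF_C_mul]

lemma dirD_zon (hd : 1 ≤ d) (hx : ‖x‖ = 1) :
    ∀ n : ℕ, dirD x (zon x (n+1)) = (n + 1) * zon x n
  | 0 => by simp [zon, dirD_linF x hx]
  | 1 => by
    have h1 := congrArg (dirD x) (zon_rec x hd 0)
    have z0 : zon x 0 = 1 := rfl
    have z1 : zon x (0 + 1) = linF x := rfl
    rw [z0, z1] at h1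
    simp only [Nat.cast_zero, zero_add, mul_zero, one_mul, mul_one] at h1
    have e1 : ((d:MvPolynomial (Fin (d+1)) ℝ) + 1) = ((d+1 : ℕ) : MvPolynomial (Fin (d+1)) ℝ) := by simp
    rw [e1, dirD_natmul, dirD_sub, dirD_natmul, dirD_mul, dirD_sqF, dirD_linF x hx] at h1
    have hne := nat_ne (d := d) hd 0
    apply mul_left_cancel₀ hne
    change _ * dirD x (zon x 2) = _ * (_ * linF x)
    push_cast at h1 ⊢
    linear_combination h1
  | n + 2 => by
    have h1 := congrArg (dirD x) (zon_rec x hd (n+1))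
    have e1 : (((n+1:ℕ):MvPolynomial (Fin (d+1)) ℝ) + d) = ((n+1+d : ℕ) : MvPolynomial (Fin (d+1)) ℝ) := by simp
    have e2 : (2 * ((n+1:ℕ):MvPolynomial (Fin (d+1)) ℝ) + d + 1) = ((2*(n+1)+d+1 : ℕ) : MvPolynomial (Fin (d+1)) ℝ) := by simp
    have e3 : (((n+1:ℕ):MvPolynomial (Fin (d+1)) ℝ) + 1) = ((n+1+1 : ℕ) : MvPolynomial (Fin (d+1)) ℝ) := by simp
    rw [e1, e2, e3, dirD_natmul, dirD_sub, dirD_natmul, dirD_natmul, dirD_mul, dirD_mul,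
      dirD_sqF, dirD_linF x hx, dirD_zon hd hx (n+1), dirD_zon hd hx n] at h1
    have hne := nat_ne (d := d) hd (n+1)
    apply mul_left_cancel₀ hne
    have h2 := zon_rec x hd n
    push_cast at h1 h2 ⊢
    linear_combination h1 - (n+2) * h2

lemma lapF_zon (hd : 1 ≤ d) (hx : ‖x‖ = 1) : ∀ n : ℕ, lapF (zon x n) = 0
  | 0 => by simp [zon, lapF]
  | 1 => by simp [zon, lapF, pderiv_linF]
  | n + 2 => by
    have h1 := congrArg lapF (zon_rec x hd n)
    have e1 : ((n:MvPolynomial (Fin (d+1)) ℝ) + d) = ((n+d : ℕ) : MvPolynomial (Fin (d+1)) ℝ) := by simp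
    have e2 : (2 * (n:MvPolynomial (Fin (d+1)) ℝ) + d + 1) = ((2*n+d+1 : ℕ) : MvPolynomial (Fin (d+1)) ℝ) := by simp
    have e3 : ((n:MvPolynomial (Fin (d+1)) ℝ) + 1) = ((n+1 : ℕ) : MvPolynomial (Fin (d+1)) ℝ) := by simp
    rw [e1, e2, e3, lapF_natmul, lapF_sub, lapF_natmul, lapF_natmul, lapF_linF_mul,
      lapF_sqF_mul _ n (zon_hom x n), lapF_zon hd hx (n+1), lapF_zon hd hx n, dirD_zon x hd hx n] at h1
    have hne := nat_ne (d := d) hd n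
    apply mul_left_cancel₀ hne
    push_cast at h1 ⊢
    linear_combination h1

/-- multi-index factorial -/
def facF {σ : Type*} [Fintype σ] (α : σ →₀ ℕ) : ℕ := ∏ i, (α i).factorial

/-- Fischer inner product. -/
noncomputable def fis (d : ℕ) :
    MvPolynomial (Fin (d+1)) ℝ →ₗ[ℝ] MvPolynomial (Fin (d+1)) ℝ →ₗ[ℝ] ℝ :=
  (basisMonomials (Fin (d+1)) ℝ).constr ℝ (fun α => (facF α : ℝ) • lcoeff ℝ α)

lemma fis_monomial (α : Fin (d+1) →₀ ℕ) (c : ℝ) (q : MvPolynomial (Fin (d+1)) ℝ) :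
    fis d (monomial α c) q = c * facF α * coeff α q := by
  have h : (monomial α c : MvPolynomial (Fin (d+1)) ℝ) = c • basisMonomials (Fin (d+1)) ℝ α := by
    simp [smul_monomial]
  rw [h, map_smul, fis, Module.Basis.constr_basis]
  simp [lcoeff_apply]
  ring

lemma fis_eq (p q : MvPolynomial (Fin (d+1)) ℝ) :
    fis d p q = ∑ α ∈ p.support, coeff α p * facF α * coeff α q := by
  conv_lhs => enter [1]; rw [p.as_sum]
  rw [map_sum, LinearMap.sum_apply]
  simp only [fis_monomial]

lemma facF_pos (α : Fin (d+1) →₀ ℕ) : 0 < facF α := Finset.prod_pos fun _ _ => Nat.factorial_pos _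

lemma fis_self_nonneg (p : MvPolynomial (Fin (d+1)) ℝ) : 0 ≤ fis d p p := by
  rw [fis_eq]
  refine Finset.sum_nonneg fun α _ => ?_
  have := mul_nonneg (Nat.cast_nonneg (α := ℝ) (facF α)) (mul_self_nonneg (coeff α p))
  linarith

lemma fis_self_eq_zero (p : MvPolynomial (Fin (d+1)) ℝ) (h : fis d p p = 0) : p = 0 := by
  rw [fis_eq, Finset.sum_eq_zero_iff_of_nonneg] at h
  · ext α
    by_contra hα
    have hα' : coeff α p ≠ 0 := by simpa using hα
    have := h α (mem_support_iff.2 hα')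
    have hp := facF_pos α
    simp [hα', hp.ne'] at this
  · intro α _
    have := mul_nonneg (Nat.cast_nonneg (α := ℝ) (facF α)) (mul_self_nonneg (coeff α p))
    linarith

lemma facF_add_single (α : Fin (d+1) →₀ ℕ) (i : Fin (d+1)) :
    facF (α + Finsupp.single i 1) = (α i + 1) * facF α := by
  classical
  unfold facF
  rw [← Finset.mul_prod_erase _ _ (Finset.mem_univ i), ← Finset.mul_prod_erase _ _ (Finset.mem_univ i),
    ← mul_assoc]
  congr 1
  · simp [Nat.factorial_succ]
  · refine Finset.prod_congr rfl fun j hj => ?_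
    have : i ≠ j := (Finset.ne_of_mem_erase hj).symm
    simp [this]

lemma fis_X_mul (i : Fin (d+1)) (p q : MvPolynomial (Fin (d+1)) ℝ) :
    fis d (X i * p) q = fis d p (pderiv i q) := by
  induction p using MvPolynomial.induction_on' with
  | add p q hp hq => simp [mul_add, hp, hq]
  | monomial α c =>
    have e : X i * monomial α c = (monomial (α + Finsupp.single i 1) c : MvPolynomial (Fin (d+1)) ℝ) := by
      rw [monomial_add_single, pow_one, mul_comm]
    rw [e, fis_monomial, fis_monomial, coeff_pderiv, facF_add_single]
    push_cast
    ring

lemma fis_sqF_mul (p q : MvPolynomial (Fin (d+1)) ℝ) :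
    fis d (sqF d * p) q = fis d p (lapF q) := by
  simp only [sqF, lapF, Finset.sum_mul, map_sum, LinearMap.sum_apply]
  refine Finset.sum_congr rfl fun i _ => ?_
  rw [pow_two, mul_assoc, fis_X_mul, fis_X_mul]

end alg

section mom
open MvPolynomial

variable {d : ℕ}

/-- Moment polynomial of a linear functional. -/
noncomputable def momP (Λ : MvPolynomial (Fin (d+1)) ℝ →ₗ[ℝ] ℝ) (n : ℕ) :
    MvPolynomial (Fin (d+1)) ℝ :=
  ∑ k ∈ Finset.piAntidiag (Finset.univ : Finset (Fin (d+1))) n,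
    monomial (Finsupp.equivFunOnFinite.symm k)
      ((Nat.multinomial Finset.univ k : ℝ) * Λ (monomial (Finsupp.equivFunOnFinite.symm k) 1))

lemma eval_momP (Λ : MvPolynomial (Fin (d+1)) ℝ →ₗ[ℝ] ℝ) (n : ℕ)
    (w : EuclideanSpace ℝ (Fin (d + 1))) :
    eval (fun i => w i) (momP Λ n) = Λ (linF w ^ n) := by
  rw [linF, Finset.sum_pow_eq_sum_piAntidiag, map_sum, momP, map_sum]
  refine Finset.sum_congr rfl fun k _ => ?_
  have h1 : (∏ i, (C (w i) * X i) ^ k i : MvPolynomial (Fin (d+1)) ℝ)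
      = (∏ i, w i ^ k i) • monomial (Finsupp.equivFunOnFinite.symm k) 1 := by
    rw [monomial_eq, smul_eq_C_mul, map_prod]
    simp only [mul_pow, Finset.prod_mul_distrib, map_pow, C_1, one_mul]
    congr 1
    rw [Finsupp.prod_fintype]
    · simp
    · simp
  rw [h1, ← nsmul_eq_mul (Nat.multinomial Finset.univ k) (_ : MvPolynomial (Fin (d+1)) ℝ), map_nsmul Λ, map_smul Λ, eval_monomial, Finsupp.prod_fintype _ _ (by simp)]
  simp
  ring

lemma fis_momP (Λ : MvPolynomial (Fin (d+1)) ℝ →ₗ[ℝ] ℝ) (n : ℕ)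
    (q : MvPolynomial (Fin (d+1)) ℝ) (hq : q.IsHomogeneous n) :
    fis d (momP Λ n) q = n.factorial * Λ q := by
  have key : ∀ β : Fin (d+1) →₀ ℕ, (∑ i, β i) = n → ∀ c : ℝ,
      fis d (momP Λ n) (monomial β c) = n.factorial * Λ (monomial β c) := by
    intro β hβ c
    rw [momP, map_sum, LinearMap.sum_apply, Finset.sum_eq_single (β : Fin (d+1) → ℕ)]
    · rw [fis_monomial]
      have e : Finsupp.equivFunOnFinite.symm (β : Fin (d+1) → ℕ) = β := by ext; simp
      have e2 : (monomial β c : MvPolynomial (Fin (d+1)) ℝ) = c • monomial β 1 := by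
        simp [smul_monomial]
      have e3 := Nat.multinomial_spec Finset.univ (β : Fin (d+1) → ℕ)
      rw [hβ] at e3
      rw [e, ← e3, e2, map_smul, coeff_smul, coeff_monomial, if_pos rfl, facF]
      push_cast
      simp only [smul_eq_mul]
      ring
    · intro k _ hk
      rw [fis_monomial, coeff_monomial, if_neg, mul_zero]
      intro h
      apply hk
      rw [h]; simp
    · intro h
      exact absurd (by simp [hβ]) h
  have hs := q.as_sum
  rw [hs, map_sum, map_sum, Finset.mul_sum]
  refine Finset.sum_congr rfl fun β hβ => key β ?_ _
  have := hq (mem_support_iff.1 hβ)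
  rw [← this]
  simp [Finsupp.weight_apply, Finsupp.sum_fintype]

lemma poly_ext (p q : MvPolynomial (Fin (d+1)) ℝ)
    (h : ∀ w : EuclideanSpace ℝ (Fin (d + 1)), eval (fun i => w i) p = eval (fun i => w i) q) :
    p = q := by
  refine MvPolynomial.funext fun f => ?_
  exact h (WithLp.toLp 2 f)

/-- Evaluation functional. -/
noncomputable def evL (x : EuclideanSpace ℝ (Fin (d + 1))) : MvPolynomial (Fin (d+1)) ℝ →ₗ[ℝ] ℝ :=
  (aeval (fun i => x i) : MvPolynomial (Fin (d+1)) ℝ →ₐ[ℝ] ℝ).toLinearMap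

lemma evL_apply (x : EuclideanSpace ℝ (Fin (d + 1))) (p : MvPolynomial (Fin (d+1)) ℝ) :
    evL x p = eval (fun i => x i) p := by
  simp [evL, aeval_eq_eval]

lemma fis_linF_pow (x : EuclideanSpace ℝ (Fin (d + 1))) (n : ℕ)
    (q : MvPolynomial (Fin (d+1)) ℝ) (hq : q.IsHomogeneous n) :
    fis d (linF x ^ n) q = n.factorial * eval (fun i => x i) q := by
  have h : momP (evL x) n = linF x ^ n := by
    refine poly_ext _ _ fun w => ?_
    rw [eval_momP, evL_apply, map_pow, map_pow, eval_linF, eval_linF, real_inner_comm]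
  rw [← h, fis_momP _ _ _ hq, evL_apply]

lemma zon_coef (hd : 1 ≤ d) (n : ℕ) : ∃ k : ℝ, 0 < k ∧
    ∀ x : EuclideanSpace ℝ (Fin (d + 1)), ∃ S, zon x n = C k * linF x ^ n + sqF d * S := by
  induction n using Nat.twoStepInduction with
  | zero => exact ⟨1, one_pos, fun x => ⟨0, by simp [zon]⟩⟩
  | one => exact ⟨1, one_pos, fun x => ⟨0, by simp [zon]⟩⟩
  | more n _ ih =>
    obtain ⟨k, hk, hS⟩ := ih
    have h : 0 < ((n:ℝ) + d) := by positivity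
    refine ⟨(2 * (n : ℝ) + d + 1) / ((n : ℝ) + d) * k, by positivity, fun x => ?_⟩
    obtain ⟨S, hS⟩ := hS x
    refine ⟨C ((2 * (n : ℝ) + d + 1) / ((n : ℝ) + d)) * linF x * S
      - C (((n : ℝ) + 1) / ((n : ℝ) + d)) * zon x n, ?_⟩
    rw [zon, hS, C_mul]
    ring

/-- Sum of Legendre kernels is a Fischer square. -/
lemma legendre_energy (hd : 1 ≤ d) (n : ℕ) : ∃ k : ℝ, 0 < k ∧
    ∀ X : Finset (EuclideanSpace ℝ (Fin (d + 1))), (∀ x ∈ X, ‖x‖ = 1) →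
    fis d (∑ x ∈ X, zon x n) (∑ x ∈ X, zon x n) = k * ∑ x ∈ X, ∑ y ∈ X, legendreP d n ⟪x, y⟫ := by
  obtain ⟨k, hk, hS⟩ := zon_coef hd n
  refine ⟨k * n.factorial, by positivity, fun X hX => ?_⟩
  rw [map_sum (fis d), LinearMap.sum_apply, Finset.mul_sum]
  refine Finset.sum_congr rfl fun x hx => ?_
  rw [map_sum, Finset.mul_sum]
  refine Finset.sum_congr rfl fun y hy => ?_
  obtain ⟨S, hS⟩ := hS x
  rw [hS, map_add, LinearMap.add_apply, fis_sqF_mul, lapF_zon y hd (hX y hy), map_zero, add_zero,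
    ← smul_eq_C_mul, map_smul, LinearMap.smul_apply, fis_linF_pow x n _ (zon_hom y n),
    eval_zon y x (hX x hx), real_inner_comm, smul_eq_mul]
  ring

lemma sphLam_sqF (p : MvPolynomial (Fin (d+1)) ℝ) : sphLam d (sqF d * p) = sphLam d p := by
  refine integral_congr_ae ?_
  filter_upwards [sphereMeasure_ae d] with y hy
  simp only [map_mul, eval_sqF, hy]
  ring

lemma sphLam_linF_pow_congr (n : ℕ) (v w : EuclideanSpace ℝ (Fin (d + 1))) (h : ‖v‖ = ‖w‖) :
    sphLam d (linF v ^ n) = sphLam d (linF w ^ n) := by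
  let e := Submodule.reflection (Submodule.span ℝ {v - w})ᗮ
  have hev : e v = w := Submodule.reflection_sub h
  have hm := (sphereMeasure_map d e).integral_comp e.toHomeomorph.measurableEmbedding
    (fun y => eval (fun i => y i) (linF w ^ n))
  change ∫ y, eval (fun i => y i) (linF v ^ n) ∂(sphereMeasure d) =
    ∫ y, eval (fun i => y i) (linF w ^ n) ∂(sphereMeasure d)
  rw [← hm]
  refine integral_congr_ae (Filter.Eventually.of_forall fun y => ?_)
  simp only [map_pow, eval_linF]
  rw [← hev, e.inner_map_map]

lemma linF_smul (r : ℝ) (v : EuclideanSpace ℝ (Fin (d + 1))) : linF (r • v) = C r * linF v := by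
  simp only [linF, Finset.mul_sum, PiLp.smul_apply, smul_eq_mul, C_mul, mul_assoc]

lemma sphLam_linF_pow (n : ℕ) : ∃ c : ℝ, (Odd n → c = 0) ∧
    ∀ w : EuclideanSpace ℝ (Fin (d + 1)), sphLam d (linF w ^ n) = c * ‖w‖ ^ n := by
  let e : EuclideanSpace ℝ (Fin (d + 1)) := EuclideanSpace.single 0 1
  have he : ‖e‖ = 1 := by simp [e]
  have hs : ∀ r : ℝ, sphLam d (linF (r • e) ^ n) = r ^ n * sphLam d (linF e ^ n) := by
    intro r
    rw [linF_smul, mul_pow, ← C_pow, ← smul_eq_C_mul, map_smul, smul_eq_mul]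
  refine ⟨sphLam d (linF e ^ n), ?_, ?_⟩
  · intro hn
    have h1 := hs (-1)
    rw [sphLam_linF_pow_congr n ((-1 : ℝ) • e) e (by simp [norm_smul]), hn.neg_one_pow] at h1
    linarith
  · intro w
    rw [sphLam_linF_pow_congr n w (‖w‖ • e) (by simp [norm_smul, he]), hs]
    ring

lemma sphLam_zon (hd : 1 ≤ d) (z : EuclideanSpace ℝ (Fin (d + 1))) (hz : ‖z‖ = 1) (n : ℕ) (hn : 1 ≤ n) :
    sphLam d (zon z n) = 0 := by
  obtain ⟨c, hc, h⟩ := sphLam_linF_pow (d := d) n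
  have hf := fis_momP (sphLam d) n _ (zon_hom z n)
  have h0 : fis d (momP (sphLam d) n) (zon z n) = 0 := by
    rcases Nat.even_or_odd n with he | ho
    · obtain ⟨j, rfl⟩ := he
      obtain ⟨i, rfl⟩ : ∃ i, j = i + 1 := ⟨j - 1, by omega⟩
      have hm : momP (sphLam d) (i + 1 + (i + 1)) = sqF d * (c • sqF d ^ i) := by
        refine poly_ext _ _ fun w => ?_
        rw [eval_momP, h]
        simp only [map_mul, smul_eval, map_pow, eval_sqF]
        ring
      rw [hm, fis_sqF_mul, lapF_zon z hd hz, map_zero]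
    · have hm : momP (sphLam d) n = 0 := by
        refine poly_ext _ _ fun w => ?_
        rw [eval_momP, h, hc ho]
        simp
      rw [hm]; simp
  rw [h0] at hf
  have : (n.factorial : ℝ) ≠ 0 := by positivity
  rcases mul_eq_zero.1 hf.symm with h | h
  · exact absurd h this
  · exact h

lemma Lam_linF_zon (hd : 1 ≤ d) (t : ℕ) (Λ : MvPolynomial (Fin (d+1)) ℝ →ₗ[ℝ] ℝ)
    (hR : ∀ p, Λ (sqF d * p) = Λ p) (z : EuclideanSpace ℝ (Fin (d + 1)))
    (h : ∀ n ≤ t, Λ (zon z n) = 0) :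
    ∀ j n, j + n ≤ t → Λ (linF z ^ j * zon z n) = 0 := by
  intro j
  induction j with
  | zero => intro n hn; simpa using h n (by omega)
  | succ j ih =>
    intro n hn
    rcases n with _ | n
    · have := ih 1 (by omega)
      simpa [zon, pow_succ] using this
    · have h1 := ih (n + 2) (by omega)
      have h2 := ih n (by omega)
      rw [zon] at h1
      have e : linF z ^ j * (C ((2 * (n : ℝ) + d + 1) / ((n : ℝ) + d)) * (linF z * zon z (n + 1))
          - C (((n : ℝ) + 1) / ((n : ℝ) + d)) * (sqF d * zon z n)) =
          ((2 * (n : ℝ) + d + 1) / ((n : ℝ) + d)) • (linF z ^ (j+1) * zon z (n+1))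
          - (((n : ℝ) + 1) / ((n : ℝ) + d)) • (sqF d * (linF z ^ j * zon z n)) := by
        rw [smul_eq_C_mul, smul_eq_C_mul]; ring
      rw [e, map_sub, map_smul, map_smul, hR, h2, smul_zero, sub_zero, smul_eq_mul] at h1
      have : (2 * (n : ℝ) + d + 1) / ((n : ℝ) + d) ≠ 0 := by positivity
      exact (mul_eq_zero.1 h1).resolve_left this

lemma Lam_zero (hd : 1 ≤ d) (t : ℕ) (Λ : MvPolynomial (Fin (d+1)) ℝ →ₗ[ℝ] ℝ)
    (hR : ∀ p, Λ (sqF d * p) = Λ p)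
    (h : ∀ z : EuclideanSpace ℝ (Fin (d + 1)), ‖z‖ = 1 → ∀ n ≤ t, Λ (zon z n) = 0)
    (p : MvPolynomial (Fin (d+1)) ℝ) (hp : p.totalDegree ≤ t) : Λ p = 0 := by
  have h1 : ∀ z : EuclideanSpace ℝ (Fin (d + 1)), ‖z‖ = 1 → ∀ n ≤ t, Λ (linF z ^ n) = 0 := by
    intro z hz n hn
    simpa [zon] using Lam_linF_zon hd t Λ hR z (h z hz) n 0 (by omega)
  have h2 : ∀ w : EuclideanSpace ℝ (Fin (d + 1)), ∀ n ≤ t, Λ (linF w ^ n) = 0 := by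
    intro w n hn
    let e : EuclideanSpace ℝ (Fin (d + 1)) := EuclideanSpace.single 0 1
    have he : ‖e‖ = 1 := by simp [e]
    obtain ⟨u, hu, hw⟩ : ∃ u : EuclideanSpace ℝ (Fin (d + 1)), ‖u‖ = 1 ∧ w = ‖w‖ • u := by
      by_cases hw : w = 0
      · exact ⟨e, he, by simp [hw]⟩
      · have : ‖w‖ ≠ 0 := by simpa using hw
        exact ⟨‖w‖⁻¹ • w, by simp [norm_smul, this], by rw [smul_smul, mul_inv_cancel₀ this, one_smul]⟩
    rw [hw, linF_smul, mul_pow, ← C_pow, ← smul_eq_C_mul, map_smul, h1 u hu n hn, smul_zero]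
  have h3 : ∀ n ≤ t, ∀ q : MvPolynomial (Fin (d+1)) ℝ, q.IsHomogeneous n → Λ q = 0 := by
    intro n hn q hq
    have hm : momP Λ n = 0 := by
      refine poly_ext _ _ fun w => ?_
      rw [eval_momP, h2 w n hn, map_zero]
    have := fis_momP Λ n q hq
    rw [hm, map_zero, LinearMap.zero_apply] at this
    have hf : (n.factorial : ℝ) ≠ 0 := by positivity
    exact (mul_eq_zero.1 this.symm).resolve_left hf
  rw [← sum_homogeneousComponent p, map_sum]
  refine Finset.sum_eq_zero fun n hn => ?_
  rw [Finset.mem_range] at hn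
  exact h3 n (by omega) _ (homogeneousComponent_isHomogeneous n p)

end mom

/-- For `p(z) = Σ_{ℓ=1}^t a_ℓ P_ℓ^{(d)}(z)` with all `a_ℓ > 0`, the energy
functional `E_p(X_N) = Σ_{(x,y) ∈ X×X} p(⟨x,y⟩)` is nonnegative, and it vanishes
if and only if `X_N` is a spherical `t`-design. -/
theorem energy_functional_nonneg_and_zero_iff_design (d t N : ℕ) (hd : 1 ≤ d) (ht : 1 ≤ t)
    (hN : 0 < N) (a : ℕ → ℝ) (ha : ∀ ℓ, 1 ≤ ℓ → ℓ ≤ t → 0 < a ℓ)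
    (X : Finset (EuclideanSpace ℝ (Fin (d + 1)))) (hcard : X.card = N)
    (hXsphere : ∀ x ∈ X, ‖x‖ = 1) :
    0 ≤ ∑ x ∈ X, ∑ y ∈ X, ∑ ℓ ∈ Finset.Icc 1 t, a ℓ * legendreP d ℓ ⟪x, y⟫ ∧
      ((∑ x ∈ X, ∑ y ∈ X, ∑ ℓ ∈ Finset.Icc 1 t, a ℓ * legendreP d ℓ ⟪x, y⟫) = 0 ↔
        IsSphericalDesign d t X) := by
  classical
  have hX0 : (X.card : ℝ) ≠ 0 := by
    rw [hcard]; exact_mod_cast hN.ne'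
  have hpos : ∀ n, 0 ≤ ∑ x ∈ X, ∑ y ∈ X, legendreP d n ⟪x, y⟫ := by
    intro n
    obtain ⟨k, hk, h⟩ := legendre_energy hd n
    have h1 := fis_self_nonneg (∑ x ∈ X, zon x n)
    rw [h X hXsphere] at h1
    exact nonneg_of_mul_nonneg_right h1 hk
  have hE : (∑ x ∈ X, ∑ y ∈ X, ∑ ℓ ∈ Finset.Icc 1 t, a ℓ * legendreP d ℓ ⟪x, y⟫) =
      ∑ ℓ ∈ Finset.Icc 1 t, a ℓ * ∑ x ∈ X, ∑ y ∈ X, legendreP d ℓ ⟪x, y⟫ := by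
    simp only [Finset.mul_sum]
    rw [Finset.sum_comm]
    rw [Finset.sum_comm]
    conv_rhs => rw [Finset.sum_comm]
    refine Finset.sum_congr rfl fun x _ => ?_
    rw [Finset.sum_comm]
  have hterm : ∀ ℓ ∈ Finset.Icc 1 t, 0 ≤ a ℓ * ∑ x ∈ X, ∑ y ∈ X, legendreP d ℓ ⟪x, y⟫ := by
    intro ℓ hℓ
    rw [Finset.mem_Icc] at hℓ
    exact mul_nonneg (ha ℓ hℓ.1 hℓ.2).le (hpos ℓ)
  rw [hE]
  refine ⟨Finset.sum_nonneg hterm, ?_⟩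
  rw [Finset.sum_eq_zero_iff_of_nonneg hterm]
  constructor
  · intro h p hp
    let Λ : MvPolynomial (Fin (d+1)) ℝ →ₗ[ℝ] ℝ := (X.card : ℝ)⁻¹ • (∑ x ∈ X, evL x) - sphLam d
    have hΛ : ∀ q, Λ q = (X.card : ℝ)⁻¹ * ∑ x ∈ X, MvPolynomial.eval (fun i => x i) q - sphLam d q := by
      intro q
      simp [Λ, LinearMap.sum_apply, evL_apply]
    have h0 := Lam_zero hd t Λ ?_ ?_ p hp
    · rw [hΛ] at h0
      exact sub_eq_zero.1 h0
    · intro q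
      rw [hΛ, hΛ, sphLam_sqF]
      congr 2
      refine Finset.sum_congr rfl fun x hx => ?_
      rw [map_mul, eval_sqF, hXsphere x hx]
      ring
    · intro z hz n hn
      rw [hΛ]
      rcases Nat.eq_zero_or_pos n with rfl | hn1
      · have h1 : sphLam d 1 = 1 := by
          simp [sphLam]
        simp [zon, h1, hX0]
      · rw [sphLam_zon hd z hz n hn1, sub_zero]
        obtain ⟨k, hk, hkE⟩ := legendre_energy hd n
        have h1 := h n (Finset.mem_Icc.2 ⟨hn1, hn⟩)
        have h2 := (mul_eq_zero.1 h1).resolve_left (ha n hn1 hn).ne'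
        have h3 := hkE X hXsphere
        rw [h2, mul_zero] at h3
        have h4 := fis_self_eq_zero _ h3
        have h5 := congrArg (MvPolynomial.eval (fun i => z i)) h4
        rw [map_sum, map_zero] at h5
        have h6 : ∑ x ∈ X, MvPolynomial.eval (fun i => x i) (zon z n) = 0 := by
          rw [← h5]
          refine Finset.sum_congr rfl fun x hx => ?_
          rw [eval_zon _ _ (hXsphere x hx), eval_zon _ _ hz, real_inner_comm]
        rw [h6, mul_zero]
  · intro h ℓ hℓ
    rw [Finset.mem_Icc] at hℓ
    rw [Finset.sum_eq_zero, mul_zero]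
    intro x hx
    have h1 := h (zon x ℓ) ((zon_hom x ℓ).totalDegree_le.trans hℓ.2)
    have h2 := sphLam_zon hd x (hXsphere x hx) ℓ hℓ.1
    change _ = sphLam d (zon x ℓ) at h1
    rw [h2] at h1
    rw [← (mul_eq_zero.1 h1).resolve_left (inv_ne_zero hX0)]
    refine Finset.sum_congr rfl fun y hy => ?_
    rw [eval_zon _ _ (hXsphere y hy)]
end

section
/- Let f : [-1, 1] → R be a continuous positive function whose Legendre expansion f(x) = Σ_{n=0}^∞ f̂(n) Z(d,n) P_n^{(d)}(x) converges absolutely and uniformly on [-1, 1], and suppose f̂(0) > 0 and f̂(n) ≤ 0 for all n > t. Then every spherical t-design X_N on S^d with N points satisfies N ≥ f(1) / f̂(0). -/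
open MeasureTheory Filter
open scoped RealInnerProductSpace

/-- `Z(d,n) = ((2n+d-1)/(d-1)) ⬝ binom(n+d-2, d-2)`, the dimension of the space of spherical
harmonics of degree `n` on `S^d`. -/
noncomputable def Zdim (d n : ℕ) : ℝ :=
  ((2 * (n : ℝ) + d - 1) / ((d : ℝ) - 1)) * (Nat.choose (n + d - 2) (d - 2) : ℝ)


namespace SphDes

open MvPolynomial

variable {m : ℕ}

/-- Fischer form. -/
noncomputable def fischer (p q : MvPolynomial (Fin m) ℝ) : ℝ :=
  ∑ a ∈ p.support, coeff a p * ((∏ i, (a i).factorial : ℕ) : ℝ) * coeff a q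

lemma fischer_eq (p q : MvPolynomial (Fin m) ℝ) (s : Finset (Fin m →₀ ℕ)) (hs : p.support ⊆ s) :
    fischer p q = ∑ a ∈ s, coeff a p * ((∏ i, (a i).factorial : ℕ) : ℝ) * coeff a q := by
  unfold fischer
  refine Finset.sum_subset hs fun a _ ha => ?_
  rw [notMem_support_iff.1 ha]; ring

lemma fischer_add (p p' q : MvPolynomial (Fin m) ℝ) :
    fischer (p + p') q = fischer p q + fischer p' q := by
  classical
  rw [fischer_eq (p + p') q (p.support ∪ p'.support) support_add,
    fischer_eq p q (p.support ∪ p'.support) Finset.subset_union_left,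
    fischer_eq p' q (p.support ∪ p'.support) Finset.subset_union_right, ← Finset.sum_add_distrib]
  exact Finset.sum_congr rfl fun _ _ => by rw [coeff_add]; ring

lemma fischer_monomial (a : Fin m →₀ ℕ) (c : ℝ) (q : MvPolynomial (Fin m) ℝ) :
    fischer (monomial a c) q = c * ((∏ i, (a i).factorial : ℕ) : ℝ) * coeff a q := by
  rw [fischer_eq _ _ {a} support_monomial_subset]
  simp

lemma fischer_C_mul (c : ℝ) (p q : MvPolynomial (Fin m) ℝ) :
    fischer (C c * p) q = c * fischer p q := by
  induction p using MvPolynomial.induction_on' with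
  | monomial a e => rw [C_mul_monomial, fischer_monomial, fischer_monomial]; ring
  | add p p' h h' => rw [mul_add, fischer_add, h, h', fischer_add]; ring

lemma fischer_zero (q : MvPolynomial (Fin m) ℝ) : fischer 0 q = 0 := by
  simp [fischer]

lemma fischer_sum {ι : Type*} (s : Finset ι) (p : ι → MvPolynomial (Fin m) ℝ)
    (q : MvPolynomial (Fin m) ℝ) :
    fischer (∑ i ∈ s, p i) q = ∑ i ∈ s, fischer (p i) q := by
  classical
  induction s using Finset.induction_on with
  | empty => simp [fischer_zero]
  | insert a s ha h => rw [Finset.sum_insert ha, fischer_add, h, Finset.sum_insert ha]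

lemma fischer_zero_right (p : MvPolynomial (Fin m) ℝ) : fischer p 0 = 0 := by
  simp [fischer]

lemma fischer_add_right (p q q' : MvPolynomial (Fin m) ℝ) :
    fischer p (q + q') = fischer p q + fischer p q' := by
  simp [fischer, mul_add, Finset.sum_add_distrib]

lemma fischer_C_mul_right (c : ℝ) (p q : MvPolynomial (Fin m) ℝ) :
    fischer p (C c * q) = c * fischer p q := by
  simp only [fischer, coeff_C_mul, Finset.mul_sum]
  exact Finset.sum_congr rfl fun _ _ => by ring

lemma fischer_sum_right {ι : Type*} (s : Finset ι) (p : ι → MvPolynomial (Fin m) ℝ)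
    (q : MvPolynomial (Fin m) ℝ) :
    fischer q (∑ i ∈ s, p i) = ∑ i ∈ s, fischer q (p i) := by
  classical
  induction s using Finset.induction_on with
  | empty => simp [fischer_zero_right]
  | insert a s ha h => rw [Finset.sum_insert ha, fischer_add_right, h, Finset.sum_insert ha]

lemma fischer_self_nonneg (p : MvPolynomial (Fin m) ℝ) : 0 ≤ fischer p p := by
  unfold fischer
  refine Finset.sum_nonneg fun a _ => ?_
  have : (0:ℝ) ≤ ((∏ i, (a i).factorial : ℕ) : ℝ) := Nat.cast_nonneg _
  have h2 := mul_nonneg this (mul_self_nonneg (coeff a p))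
  calc (0:ℝ) ≤ _ := h2
    _ = coeff a p * ((∏ i, (a i).factorial : ℕ) : ℝ) * coeff a p := by ring

lemma fischer_X_mul (i : Fin m) (p q : MvPolynomial (Fin m) ℝ) :
    fischer (X i * p) q = fischer p (pderiv i q) := by
  classical
  induction p using MvPolynomial.induction_on' with
  | monomial a e =>
    rw [X, monomial_mul, fischer_monomial, fischer_monomial, coeff_pderiv]
    have : (∏ j, ((Finsupp.single i 1 + a : Fin m →₀ ℕ) j).factorial) = (a i + 1) * ∏ j, (a j).factorial := by
      rw [← Finset.mul_prod_erase _ _ (Finset.mem_univ i),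
        ← Finset.mul_prod_erase Finset.univ (fun j => (a j).factorial) (Finset.mem_univ i)]
      have : ∏ x ∈ Finset.univ.erase i, ((Finsupp.single i 1 + a : Fin m →₀ ℕ) x).factorial
          = ∏ x ∈ Finset.univ.erase i, (a x).factorial := by
        refine Finset.prod_congr rfl fun x hx => ?_
        have hx' : i ≠ x := fun h => (Finset.ne_of_mem_erase hx) h.symm
        simp [Finsupp.single_apply, hx']
      rw [this]
      simp only [Finsupp.add_apply, Finsupp.single_eq_same]
      rw [add_comm 1 (a i), Nat.factorial_succ]; ring
    rw [this, add_comm (Finsupp.single i 1) a]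
    push_cast
    ring
  | add p p' h h' => rw [mul_add, fischer_add, h, h', fischer_add]

lemma pderiv_comm (i j : Fin m) (q : MvPolynomial (Fin m) ℝ) :
    pderiv i (pderiv j q) = pderiv j (pderiv i q) := by
  classical
  ext a
  simp only [coeff_pderiv]
  by_cases h : i = j
  · subst h; rfl
  · rw [add_right_comm]
    simp [Finsupp.single_apply, h, Ne.symm h]
    ring

noncomputable def dir (y : Fin m → ℝ) (q : MvPolynomial (Fin m) ℝ) : MvPolynomial (Fin m) ℝ :=
  ∑ i, C (y i) * pderiv i q

noncomputable def lap (q : MvPolynomial (Fin m) ℝ) : MvPolynomial (Fin m) ℝ :=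
  ∑ i, pderiv i (pderiv i q)

noncomputable def lin (y : Fin m → ℝ) : MvPolynomial (Fin m) ℝ := ∑ i, C (y i) * X i

noncomputable def rho : MvPolynomial (Fin m) ℝ := ∑ i, X i * X i

lemma fischer_lin_mul (y : Fin m → ℝ) (p q : MvPolynomial (Fin m) ℝ) :
    fischer (lin y * p) q = fischer p (dir y q) := by
  simp only [lin, dir, Finset.sum_mul, fischer_sum, fischer_sum_right, mul_assoc, fischer_C_mul,
    fischer_X_mul, fischer_C_mul_right]

lemma fischer_rho_mul (p q : MvPolynomial (Fin m) ℝ) :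
    fischer (rho * p) q = fischer p (lap q) := by
  simp only [rho, lap, Finset.sum_mul, fischer_sum, fischer_sum_right, mul_assoc, fischer_X_mul]

lemma lap_dir (y : Fin m → ℝ) (q : MvPolynomial (Fin m) ℝ) : lap (dir y q) = dir y (lap q) := by
  simp only [lap, dir, map_sum, pderiv_C_mul, Finset.mul_sum]
  rw [Finset.sum_comm]
  refine Finset.sum_congr rfl fun i _ => Finset.sum_congr rfl fun j _ => ?_
  rw [pderiv_comm j i q, pderiv_comm j i]

lemma dir_mul (y : Fin m → ℝ) (p q : MvPolynomial (Fin m) ℝ) :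
    dir y (p * q) = dir y p * q + p * dir y q := by
  simp only [dir, pderiv_mul, Finset.sum_mul, Finset.mul_sum, ← Finset.sum_add_distrib]
  exact Finset.sum_congr rfl fun _ _ => by ring

lemma dir_sub (y : Fin m → ℝ) (p q : MvPolynomial (Fin m) ℝ) :
    dir y (p - q) = dir y p - dir y q := by
  simp only [dir, map_sub, mul_sub, Finset.sum_sub_distrib]

lemma dir_C_mul (y : Fin m → ℝ) (c : ℝ) (q : MvPolynomial (Fin m) ℝ) :
    dir y (C c * q) = C c * dir y q := by
  simp only [dir, pderiv_C_mul, Finset.mul_sum]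
  exact Finset.sum_congr rfl fun _ _ => by ring

lemma lap_sub (p q : MvPolynomial (Fin m) ℝ) : lap (p - q) = lap p - lap q := by
  simp only [lap, map_sub, Finset.sum_sub_distrib]

lemma lap_C_mul (c : ℝ) (q : MvPolynomial (Fin m) ℝ) : lap (C c * q) = C c * lap q := by
  simp only [lap, pderiv_C_mul, Finset.mul_sum]

lemma pderiv_lin (y : Fin m → ℝ) (i : Fin m) : pderiv i (lin y) = C (y i) := by
  classical
  simp [lin, map_sum, pderiv_C_mul, pderiv_X, Pi.single_apply]

lemma pderiv_rho (i : Fin m) : pderiv i (rho : MvPolynomial (Fin m) ℝ) = 2 * X i := by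
  classical
  simp [rho, map_sum, pderiv_mul, pderiv_X, Pi.single_apply, Finset.sum_add_distrib]
  ring

lemma lap_mul (p q : MvPolynomial (Fin m) ℝ) :
    lap (p * q) = lap p * q + p * lap q + 2 * ∑ i, pderiv i p * pderiv i q := by
  simp only [lap, pderiv_mul, map_add, Finset.sum_mul, Finset.mul_sum, ← Finset.sum_add_distrib]
  exact Finset.sum_congr rfl fun _ _ => by ring

lemma lap_lin_mul (y : Fin m → ℝ) (q : MvPolynomial (Fin m) ℝ) :
    lap (lin y * q) = lin y * lap q + 2 * dir y q := by
  rw [lap_mul]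
  have : lap (lin y) = 0 := by simp [lap, pderiv_lin]
  rw [this]
  simp only [pderiv_lin, dir]
  ring

lemma lap_rho_mul {n : ℕ} (q : MvPolynomial (Fin m) ℝ) (hq : q.IsHomogeneous n) :
    lap (rho * q) = rho * lap q + C (2 * (m : ℝ) + 4 * n) * q := by
  rw [lap_mul]
  have : lap (rho : MvPolynomial (Fin m) ℝ) = C (2 * (m : ℝ)) := by
    have h2 : (2 : MvPolynomial (Fin m) ℝ) = C (2:ℝ) := (map_ofNat C 2).symm
    simp only [lap, pderiv_rho]
    rw [h2]
    simp only [pderiv_C_mul, pderiv_X_self]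
    simp
    ring
  rw [this]
  have he := hq.sum_X_mul_pderiv
  simp only [pderiv_rho, mul_assoc, ← Finset.mul_sum, he]
  have e2 : (C 2 : MvPolynomial (Fin m) ℝ) = 2 := map_ofNat C 2
  have e4 : (C 4 : MvPolynomial (Fin m) ℝ) = 4 := map_ofNat C 4
  simp [e2, e4]
  ring

lemma dir_lin (y : Fin m → ℝ) : dir y (lin y) = C (∑ i, y i ^ 2) := by
  simp [dir, pderiv_lin, pow_two]

lemma dir_rho (y : Fin m → ℝ) : dir y rho = 2 * lin y := by
  simp only [dir, pderiv_rho, lin, Finset.mul_sum]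
  exact Finset.sum_congr rfl fun _ _ => by ring

lemma lin_hom (y : Fin m → ℝ) : (lin y).IsHomogeneous 1 := by
  refine IsHomogeneous.sum _ _ _ fun i _ => ?_
  simpa using (isHomogeneous_C _ (y i)).mul (isHomogeneous_X ℝ i)

lemma rho_hom : (rho : MvPolynomial (Fin m) ℝ).IsHomogeneous 2 := by
  refine IsHomogeneous.sum _ _ _ fun i _ => ?_
  simpa using (isHomogeneous_X ℝ i).mul (isHomogeneous_X ℝ i)

lemma C_mul_hom {n : ℕ} (c : ℝ) {q : MvPolynomial (Fin m) ℝ} (hq : q.IsHomogeneous n) :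
    (C c * q).IsHomogeneous n := by
  simpa using (isHomogeneous_C _ c).mul hq

lemma dir_hom {n : ℕ} (y : Fin m → ℝ) {q : MvPolynomial (Fin m) ℝ}
    (hq : q.IsHomogeneous (n + 1)) : (dir y q).IsHomogeneous n := by
  refine IsHomogeneous.sum _ _ _ fun i _ => C_mul_hom _ ?_
  simpa using hq.pderiv (i := i)

lemma eval_dir {n : ℕ} (y : Fin m → ℝ) {q : MvPolynomial (Fin m) ℝ}
    (hq : q.IsHomogeneous n) : eval y (dir y q) = n * eval y q := by
  have := congrArg (eval y) hq.sum_X_mul_pderiv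
  simpa [dir] using this

/-- Homogeneous zonal harmonic. -/
noncomputable def HP (d : ℕ) (y : Fin (d + 1) → ℝ) : ℕ → MvPolynomial (Fin (d + 1)) ℝ
  | 0 => 1
  | 1 => lin y
  | n + 2 => C (((n : ℝ) + d)⁻¹) *
      (C (2 * (n : ℝ) + d + 1) * (lin y * HP d y (n + 1)) - C ((n : ℝ) + 1) * (rho * HP d y n))

lemma HP_hom (d : ℕ) (y : Fin (d + 1) → ℝ) : ∀ n, (HP d y n).IsHomogeneous n
  | 0 => by simpa [HP] using isHomogeneous_one _ _
  | 1 => by simpa [HP] using lin_hom y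
  | n + 2 => by
    rw [HP]
    have h1 := (lin_hom y).mul (HP_hom d y (n + 1))
    have h2 := (rho_hom).mul (HP_hom d y n)
    rw [show 1 + (n + 1) = n + 2 by ring] at h1
    rw [show 2 + n = n + 2 by ring] at h2
    exact C_mul_hom _ ((C_mul_hom _ h1).sub (C_mul_hom _ h2))

lemma HP_rec (d : ℕ) (hd : 1 ≤ d) (y : Fin (d + 1) → ℝ) (n : ℕ) :
    ((n : MvPolynomial (Fin (d + 1)) ℝ) + (d : MvPolynomial (Fin (d + 1)) ℝ)) * HP d y (n + 2) =
      (2 * (n : MvPolynomial (Fin (d + 1)) ℝ) + (d : MvPolynomial (Fin (d + 1)) ℝ) + 1) * (lin y * HP d y (n + 1)) -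
        ((n : MvPolynomial (Fin (d + 1)) ℝ) + 1) * (rho * HP d y n) := by
  have h : ((n : MvPolynomial (Fin (d + 1)) ℝ) + (d : MvPolynomial (Fin (d + 1)) ℝ)) * C (((n : ℝ) + d)⁻¹) = 1 := by
    have h0 : ((n : ℝ) + d) ≠ 0 := by positivity
    rw [show ((n : MvPolynomial (Fin (d + 1)) ℝ) + (d : MvPolynomial (Fin (d + 1)) ℝ)) = C ((n : ℝ) + d) by simp, ← C_mul,
      mul_inv_cancel₀ h0, C_1]
  rw [HP, ← mul_assoc, h, one_mul]
  simp [map_ofNat C 2]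

lemma cancel_nat {d : ℕ} (hd : 1 ≤ d) (n : ℕ) {p q : MvPolynomial (Fin (d + 1)) ℝ}
    (h : ((n : MvPolynomial (Fin (d + 1)) ℝ) + (d : MvPolynomial (Fin (d + 1)) ℝ)) * p = ((n : MvPolynomial (Fin (d + 1)) ℝ) + (d : MvPolynomial (Fin (d + 1)) ℝ)) * q) :
    p = q := by
  have h0 : ((n : MvPolynomial (Fin (d + 1)) ℝ) + (d : MvPolynomial (Fin (d + 1)) ℝ)) ≠ 0 := by
    have : ((n + d : ℕ) : MvPolynomial (Fin (d + 1)) ℝ) ≠ 0 := by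
      rw [Nat.cast_ne_zero]; omega
    simpa using this
  exact mul_left_cancel₀ h0 h

lemma dir_HP (d : ℕ) (hd : 1 ≤ d) (y : Fin (d + 1) → ℝ) (hy : ∑ i, y i ^ 2 = 1) :
    ∀ n : ℕ, dir y (HP d y (n + 1)) = ((n : MvPolynomial (Fin (d + 1)) ℝ) + 1) * HP d y n := by
  have key : ∀ n : ℕ, ((n : MvPolynomial (Fin (d + 1)) ℝ) + (d : MvPolynomial (Fin (d + 1)) ℝ)) * dir y (HP d y (n + 2)) =
      (2 * (n : MvPolynomial (Fin (d + 1)) ℝ) + (d : MvPolynomial (Fin (d + 1)) ℝ) + 1) *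
        (HP d y (n + 1) + lin y * dir y (HP d y (n + 1))) -
        ((n : MvPolynomial (Fin (d + 1)) ℝ) + 1) * (2 * lin y * HP d y n + rho * dir y (HP d y n)) := by
    intro n
    have := congrArg (dir y) (HP_rec d hd y n)
    rw [dir_sub, show ((n : MvPolynomial (Fin (d + 1)) ℝ) + (d : MvPolynomial (Fin (d + 1)) ℝ)) = C ((n : ℝ) + d) by simp,
      show (2 * (n : MvPolynomial (Fin (d + 1)) ℝ) + (d : MvPolynomial (Fin (d + 1)) ℝ) + 1) = C (2 * (n : ℝ) + d + 1) by simp [map_ofNat C 2],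
      show ((n : MvPolynomial (Fin (d + 1)) ℝ) + 1) = C ((n : ℝ) + 1) by simp,
      dir_C_mul, dir_C_mul, dir_C_mul, dir_mul, dir_mul, dir_lin, dir_rho, hy] at this
    simpa [map_ofNat C 2] using this
  intro n
  induction n using Nat.strong_induction_on with
  | _ n ih =>
    match n with
    | 0 => simp [HP, dir_lin, hy]
    | 1 =>
      apply cancel_nat hd 0
      have := key 0
      have h0 : dir y (HP d y 0) = 0 := by simp [HP, dir]
      have h1 := ih 0 (by norm_num)
      simp only [zero_add] at this h1
      rw [h0, h1] at this
      simp only [HP] at this ⊢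
      push_cast at this ⊢
      linear_combination this
    | n + 2 =>
      apply cancel_nat hd (n + 1)
      have h := key (n + 1)
      have h1 := ih (n + 1) (by omega)
      have h2 := ih n (by omega)
      have hr := HP_rec d hd y n
      rw [show n + 1 + 2 = n + 2 + 1 by ring, show n + 1 + 1 = n + 2 by ring] at h
      rw [show n + 1 + 1 = n + 2 by ring] at h1
      rw [h1, h2] at h
      push_cast at h ⊢
      linear_combination h - ((n : MvPolynomial (Fin (d + 1)) ℝ) + 2) * hr

lemma lap_HP (d : ℕ) (hd : 1 ≤ d) (y : Fin (d + 1) → ℝ) (hy : ∑ i, y i ^ 2 = 1) :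
    ∀ n : ℕ, lap (HP d y n) = 0
  | 0 => by simp [HP, lap]
  | 1 => by simp [HP, lap, pderiv_lin]
  | n + 2 => by
    have h1 := lap_HP d hd y hy (n + 1)
    have h0 := lap_HP d hd y hy n
    have hD := dir_HP d hd y hy n
    rw [HP, lap_C_mul, lap_sub, lap_C_mul, lap_C_mul, lap_lin_mul, lap_rho_mul _ (HP_hom d y n),
      h1, h0, hD]
    have : (C (2 * (n : ℝ) + d + 1) * (lin y * 0 + 2 * (((n : MvPolynomial (Fin (d + 1)) ℝ) + 1) * HP d y n)) -
        C ((n : ℝ) + 1) * (rho * 0 + C (2 * ((d + 1 : ℕ) : ℝ) + 4 * n) * HP d y n)) = 0 := by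
      have e2 : (C 2 : MvPolynomial (Fin (d + 1)) ℝ) = 2 := map_ofNat C 2
      have e4 : (C 4 : MvPolynomial (Fin (d + 1)) ℝ) = 4 := map_ofNat C 4
      simp [e2, e4]
      ring
    rw [this, mul_zero]

noncomputable def cst (d : ℕ) : ℕ → ℝ
  | 0 => 1
  | 1 => 1
  | n + 2 => ((n : ℝ) + d)⁻¹ * ((2 * (n : ℝ) + d + 1) * ((n + 2) * cst d (n + 1)))

lemma cst_pos (d : ℕ) (hd : 1 ≤ d) : ∀ n, 0 < cst d n
  | 0 => by simp [cst]
  | 1 => by simp [cst]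
  | n + 2 => by
    have := cst_pos d hd (n + 1)
    rw [cst]; positivity

lemma reproducing (d : ℕ) (x : Fin (d + 1) → ℝ) :
    ∀ (n : ℕ) (q : MvPolynomial (Fin (d + 1)) ℝ), q.IsHomogeneous n → lap q = 0 →
      fischer (HP d x n) q = cst d n * eval x q
  | 0, q, hq, _ => by
    have : (1 : MvPolynomial (Fin (d + 1)) ℝ) = monomial 0 1 := rfl
    rw [HP, this, fischer_monomial, cst]
    have h0 := (totalDegree_eq_zero_iff_eq_C (p := q)).1 (by simpa using hq.totalDegree_le)
    rw [h0]; simp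
  | 1, q, hq, _ => by
    rw [HP, ← mul_one (lin x), fischer_lin_mul]
    have : (1 : MvPolynomial (Fin (d + 1)) ℝ) = monomial 0 1 := rfl
    rw [this, fischer_monomial, cst]
    have hd0 := dir_hom (n := 0) x hq
    have h0 := (totalDegree_eq_zero_iff_eq_C (p := dir x q)).1 (by simpa using hd0.totalDegree_le)
    have he := eval_dir x hq
    rw [h0] at he
    simpa using he
  | n + 2, q, hq, hl => by
    have ih := reproducing d x (n + 1) (dir x q) (dir_hom x hq) (by rw [lap_dir, hl]; simp [dir])
    rw [eval_dir x hq] at ih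
    have hs : ∀ a b : MvPolynomial (Fin (d + 1)) ℝ, fischer (a - b) q = fischer a q - fischer b q := by
      intro a b
      have := fischer_add (a - b) b q
      rw [sub_add_cancel] at this
      linarith
    rw [HP, fischer_C_mul, hs, fischer_C_mul, fischer_C_mul, fischer_lin_mul, fischer_rho_mul, hl,
      fischer_zero_right, ih, cst]
    push_cast
    ring

lemma HP_psd (d : ℕ) (hd : 1 ≤ d) (n : ℕ) (X : Finset (EuclideanSpace ℝ (Fin (d + 1))))
    (hX : ∀ x ∈ X, ∑ i, x i ^ 2 = 1) :
    0 ≤ ∑ x ∈ X, ∑ y ∈ X, eval (fun i => y i) (HP d (fun i => x i) n) := by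
  set h := ∑ x ∈ X, HP d (fun i => x i) n with hh
  have hhom : h.IsHomogeneous n := IsHomogeneous.sum _ _ _ fun x _ => HP_hom _ _ _
  have hlap : lap h = 0 := by
    have : lap h = ∑ x ∈ X, lap (HP d (fun i => x i) n) := by
      simp only [hh, lap, map_sum]
      rw [Finset.sum_comm]
    rw [this]
    exact Finset.sum_eq_zero fun x hx => lap_HP d hd _ (hX x hx) n
  have h1 := fischer_self_nonneg h
  have h2 : fischer h h = cst d n * ∑ y ∈ X, eval (fun i => y i) h := by
    conv_lhs => rw [hh]
    rw [fischer_sum, Finset.mul_sum]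
    exact Finset.sum_congr rfl fun y _ => reproducing d _ n h hhom hlap
  rw [h2] at h1
  have h3 := nonneg_of_mul_nonneg_right h1 (cst_pos d hd n)
  rw [Finset.sum_comm]
  simpa [hh] using h3

lemma eval_HP (d : ℕ) (x y : EuclideanSpace ℝ (Fin (d + 1))) (hy : ∑ i, y i ^ 2 = 1) :
    ∀ n, eval (fun i => y i) (HP d (fun i => x i) n) = legendreP d n (inner ℝ x y)
  | 0 => by simp [HP, legendreP]
  | 1 => by
    simp [HP, legendreP, lin, PiLp.inner_apply, mul_comm]
  | n + 2 => by
    have h1 := eval_HP d x y hy (n + 1)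
    have h0 := eval_HP d x y hy n
    have hl : eval (fun i => y i) (lin fun i => x i) = inner ℝ x y := by
      simp [lin, PiLp.inner_apply, mul_comm]
    have hr : eval (fun i => y i) (rho : MvPolynomial (Fin (d + 1)) ℝ) = 1 := by
      simpa [rho, pow_two] using hy
    rw [HP, legendreP]
    simp only [map_mul, map_sub, eval_C, h1, h0, hl, hr]
    rw [div_eq_mul_inv]; ring


end SphDes

namespace SphDes

section ode
open Polynomial

noncomputable def PP (d : ℕ) : ℕ → ℝ[X]
  | 0 => 1
  | 1 => X
  | n + 2 => C (((n : ℝ) + d)⁻¹) *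
      ((2 * (n : ℝ[X]) + (d : ℝ[X]) + 1) * X * PP d (n + 1) - ((n : ℝ[X]) + 1) * PP d n)

lemma PP_eval (d : ℕ) (x : ℝ) : ∀ n, (PP d n).eval x = legendreP d n x
  | 0 => by simp [PP, legendreP]
  | 1 => by simp [PP, legendreP]
  | n + 2 => by
    have h1 := PP_eval d x (n + 1)
    have h0 := PP_eval d x n
    rw [PP, legendreP]
    simp [h1, h0]
    rw [div_eq_mul_inv]; ring

lemma PP_rec (d : ℕ) (hd : 2 ≤ d) (n : ℕ) :
    ((n : ℝ[X]) + (d : ℝ[X])) * PP d (n + 2) =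
      (2 * (n : ℝ[X]) + (d : ℝ[X]) + 1) * X * PP d (n + 1) - ((n : ℝ[X]) + 1) * PP d n := by
  have h : ((n : ℝ[X]) + (d : ℝ[X])) * C (((n : ℝ) + d)⁻¹) = 1 := by
    have h0 : ((n : ℝ) + d) ≠ 0 := by positivity
    rw [show ((n : ℝ[X]) + (d : ℝ[X])) = C ((n : ℝ) + d) by simp, ← C_mul,
      mul_inv_cancel₀ h0, C_1]
  rw [PP, ← mul_assoc, h, one_mul]

lemma PP_ode (d : ℕ) (hd : 2 ≤ d) (n : ℕ) :
    ((1 - X ^ 2) * derivative (derivative (PP d n)) - (d : ℝ[X]) * X * derivative (PP d n)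
      + (n : ℝ[X]) * ((n : ℝ[X]) + (d : ℝ[X]) - 1) * PP d n = 0) ∧
    (((n : ℝ[X]) + (d : ℝ[X]) - 1) * PP d (n + 1) =
      ((n : ℝ[X]) + (d : ℝ[X]) - 1) * X * PP d n - (1 - X ^ 2) * derivative (PP d n)) := by
  induction n with
  | zero => simp [PP]
  | succ n ih =>
    obtain ⟨ho, hr⟩ := ih
    have ha : ((n : ℝ[X]) + (d : ℝ[X]) - 1) ≠ 0 := by
      have : ((n + (d - 1) : ℕ) : ℝ[X]) ≠ 0 := by
        rw [Nat.cast_ne_zero]; omega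
      rw [Nat.cast_add, Nat.cast_sub (by omega)] at this
      intro h; apply this; push_cast; linear_combination h
    have hD : ((n : ℝ[X]) + (d : ℝ[X]) - 1) * derivative (PP d (n + 1)) =
        ((n : ℝ[X]) + 1) * (((n : ℝ[X]) + (d : ℝ[X]) - 1) * PP d n + X * derivative (PP d n)) := by
      have := congrArg derivative hr
      simp at this
      linear_combination this - ho
    have hD2 : ((n : ℝ[X]) + (d : ℝ[X]) - 1) * derivative (derivative (PP d (n + 1))) =
        ((n : ℝ[X]) + 1) * (((n : ℝ[X]) + (d : ℝ[X]) - 1) * derivative (PP d n)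
          + derivative (PP d n) + X * derivative (derivative (PP d n))) := by
      have := congrArg derivative hD
      simp at this
      linear_combination this
    constructor
    · apply mul_left_cancel₀ ha
      push_cast
      linear_combination (1 - X ^ 2) * hD2 - (d : ℝ[X]) * X * hD
        + ((n : ℝ[X]) + 1) * ((n : ℝ[X]) + (d : ℝ[X])) * hr + ((n : ℝ[X]) + 1) * X * ho
    · apply mul_left_cancel₀ ha
      have hrec := PP_rec d hd n
      push_cast
      linear_combination ((n : ℝ[X]) + (d : ℝ[X]) - 1) * hrec + (1 - X ^ 2) * hD
        + ((n : ℝ[X]) + 1) * X * hr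

end ode

section hausdorff

variable {d : ℕ}

lemma sphere_pos : 0 < μH[(d : ℝ)] (Metric.sphere (0 : EuclideanSpace ℝ (Fin (d + 1))) 1) := by
  let π : EuclideanSpace ℝ (Fin (d + 1)) → (Fin d → ℝ) := fun y k => y k.succ
  have hπ : LipschitzWith 1 π := by
    refine LipschitzWith.of_dist_le_mul fun y z => ?_
    rw [NNReal.coe_one, one_mul, dist_pi_le_iff dist_nonneg]
    intro k
    rw [dist_eq_norm, dist_eq_norm]
    exact PiLp.norm_apply_le (y - z) k.succ
  have himg := hπ.hausdorffMeasure_image_le (d := (d : ℝ)) (by positivity)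
    (Metric.sphere (0 : EuclideanSpace ℝ (Fin (d + 1))) 1)
  have hvol : (μH[(d : ℝ)] : Measure (Fin d → ℝ)) = volume := by
    have := hausdorffMeasure_pi_real (ι := Fin d)
    simpa using this
  rw [hvol] at himg
  have hU : IsOpen {u : Fin d → ℝ | ∑ k, u k ^ 2 < 1} :=
    isOpen_lt (by fun_prop) continuous_const
  have hpos : 0 < volume {u : Fin d → ℝ | ∑ k, u k ^ 2 < 1} :=
    hU.measure_pos volume ⟨0, by simp⟩
  have hsub : {u : Fin d → ℝ | ∑ k, u k ^ 2 < 1} ⊆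
      π '' (Metric.sphere (0 : EuclideanSpace ℝ (Fin (d + 1))) 1) := by
    intro u hu
    refine ⟨WithLp.toLp 2 (Fin.cons (√(1 - ∑ k, u k ^ 2)) u), ?_, ?_⟩
    · rw [mem_sphere_zero_iff_norm, EuclideanSpace.norm_eq, Real.sqrt_eq_one, Fin.sum_univ_succ]
      simp only [Set.mem_setOf_eq] at hu
      simp [Real.sq_sqrt (sub_nonneg.2 hu.le)]
    · ext k; simp [π]
  have := hpos.trans_le ((measure_mono hsub).trans himg)
  simpa using this

/-- normalised face parametrisation -/
noncomputable def face (i : Fin (d + 1)) (e : ℝ) (u : Fin d → ℝ) : EuclideanSpace ℝ (Fin (d + 1)) :=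
  WithLp.toLp 2 (i.insertNth (α := fun _ => ℝ) e u)

lemma face_ne (i : Fin (d + 1)) (e : ℝ) (he : e ≠ 0) (u : Fin d → ℝ) : face i e u ≠ 0 := by
  intro h
  have : face i e u i = 0 := by rw [h]; rfl
  simp [face] at this
  exact he this

lemma face_contDiff (i : Fin (d + 1)) (e : ℝ) (he : e ≠ 0) :
    ContDiff ℝ 1 (fun u : Fin d → ℝ => ‖face i e u‖⁻¹ • face i e u) := by
  have h : ContDiff ℝ 1 (fun u : Fin d → ℝ => face i e u) := by
    rw [contDiff_euclidean]
    intro j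
    rcases Fin.eq_self_or_eq_succAbove i j with rfl | ⟨k, rfl⟩
    · simp only [face, Fin.insertNth_apply_same]; exact contDiff_const
    · simp only [face, Fin.insertNth_apply_succAbove]; fun_prop
  exact ((h.norm ℝ (face_ne i e he)).inv (fun u => norm_ne_zero_iff.2 (face_ne i e he u))).smul h

lemma sphere_cover : Metric.sphere (0 : EuclideanSpace ℝ (Fin (d + 1))) 1 ⊆
    ⋃ i : Fin (d + 1), ⋃ b : Bool,
      (fun u : Fin d → ℝ => ‖face i (if b then 1 else -1) u‖⁻¹ • face i (if b then 1 else -1) u) ''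
        Set.Icc (-1) 1 := by
  intro y hy
  rw [mem_sphere_zero_iff_norm] at hy
  obtain ⟨i, -, hi⟩ := Finset.exists_max_image Finset.univ (fun i => |y i|) Finset.univ_nonempty
  have hyi : 0 < |y i| := by
    by_contra hcon
    have h0 : y = 0 := by
      ext j
      have := hi j (Finset.mem_univ j)
      have : |y j| ≤ 0 := this.trans (not_lt.1 hcon)
      simpa using this
    simp [h0] at hy
  have key : ∀ e : ℝ, y i = |y i| * e →
      (fun u : Fin d → ℝ => ‖face i e u‖⁻¹ • face i e u) (fun k => |y i|⁻¹ * y (i.succAbove k)) = y := by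
    intro e he
    have : face i e (fun k => |y i|⁻¹ * y (i.succAbove k)) = |y i|⁻¹ • y := by
      ext j
      rcases Fin.eq_self_or_eq_succAbove i j with rfl | ⟨k, rfl⟩
      · simp only [face, Fin.insertNth_apply_same, PiLp.smul_apply, smul_eq_mul]
        rw [eq_inv_mul_iff_mul_eq₀ hyi.ne']; exact he.symm
      · simp only [face, Fin.insertNth_apply_succAbove, PiLp.smul_apply, smul_eq_mul]
    simp only [this, norm_smul, hy, norm_inv, Real.norm_eq_abs, abs_abs, mul_one, inv_inv, smul_smul]
    rw [mul_inv_cancel₀ hyi.ne', one_smul]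
  have hu : (fun k => |y i|⁻¹ * y (i.succAbove k)) ∈ Set.Icc (-1 : Fin d → ℝ) 1 := by
    have : ∀ k, |(|y i|⁻¹ * y (i.succAbove k))| ≤ 1 := by
      intro k
      rw [abs_mul, abs_inv, abs_abs, inv_mul_le_iff₀ hyi, mul_one]
      exact hi _ (Finset.mem_univ _)
    exact ⟨fun k => (abs_le.1 (this k)).1, fun k => (abs_le.1 (this k)).2⟩
  simp only [Set.mem_iUnion]
  refine ⟨i, ?_⟩
  rcases le_or_gt 0 (y i) with h | h
  · exact ⟨true, _, hu, key _ (by simp [abs_of_nonneg h])⟩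
  · exact ⟨false, _, hu, key _ (by simp [abs_of_neg h])⟩

lemma sphere_lt_top : μH[(d : ℝ)] (Metric.sphere (0 : EuclideanSpace ℝ (Fin (d + 1))) 1) < ⊤ := by
  refine (measure_mono sphere_cover).trans_lt ?_
  refine (measure_iUnion_le _).trans_lt ?_
  rw [tsum_fintype]
  refine ENNReal.sum_lt_top.2 fun i _ => ?_
  refine (measure_iUnion_le _).trans_lt ?_
  rw [tsum_fintype]
  refine ENNReal.sum_lt_top.2 fun b _ => ?_
  have he : (if b then (1:ℝ) else -1) ≠ 0 := by split_ifs <;> norm_num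
  obtain ⟨K, hK⟩ := ((face_contDiff (d := d) i _ he).locallyLipschitz.locallyLipschitzOn
    (s := Set.Icc (-1) 1)).exists_lipschitzOnWith_of_compact isCompact_Icc
  refine (hK.hausdorffMeasure_image_le (d := (d : ℝ)) (by positivity)).trans_lt ?_
  have hvol : (μH[(d : ℝ)] : Measure (Fin d → ℝ)) = volume := by
    have := hausdorffMeasure_pi_real (ι := Fin d)
    simpa using this
  rw [hvol]
  exact ENNReal.mul_lt_top (ENNReal.rpow_lt_top_of_nonneg (by positivity) ENNReal.coe_ne_top)
    isCompact_Icc.measure_lt_top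

instance : IsProbabilityMeasure (sphereMeasure d) := by
  constructor
  rw [sphereMeasure, Measure.smul_apply, Measure.restrict_apply_univ, smul_eq_mul]
  exact ENNReal.inv_mul_cancel sphere_pos.ne' sphere_lt_top.ne

lemma ae_sphere : ∀ᵐ y ∂(sphereMeasure d), ‖y‖ = 1 := by
  refine Measure.ae_smul_measure ?_ _
  filter_upwards [ae_restrict_mem Metric.isClosed_sphere.measurableSet] with y hy
  simpa using hy

lemma sphere_mp (e : EuclideanSpace ℝ (Fin (d + 1)) ≃ₗᵢ[ℝ] EuclideanSpace ℝ (Fin (d + 1))) :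
    MeasurePreserving e (sphereMeasure d) (sphereMeasure d) := by
  have h1 : MeasurePreserving e (μH[(d:ℝ)]) (μH[(d:ℝ)]) :=
    e.toIsometryEquiv.measurePreserving_hausdorffMeasure (d : ℝ)
  have h2 := h1.restrict_preimage (s := Metric.sphere 0 1) Metric.isClosed_sphere.measurableSet
  have h3 : e ⁻¹' Metric.sphere 0 1 = Metric.sphere 0 1 := by
    ext y; simp
  rw [h3] at h2
  exact h2.smul_measure _

lemma sphere_int {F : EuclideanSpace ℝ (Fin (d + 1)) → ℝ} (hF : Continuous F) :
    Integrable F (sphereMeasure d) := by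
  obtain ⟨C, hC⟩ := (isCompact_sphere (0 : EuclideanSpace ℝ (Fin (d + 1))) 1).exists_bound_of_continuousOn
    hF.continuousOn
  refine Integrable.of_bound hF.aestronglyMeasurable C ?_
  filter_upwards [ae_sphere] with y hy
  exact hC y (by simpa using hy)

open Polynomial in
lemma rot_inv (q : ℝ[X]) (x u : EuclideanSpace ℝ (Fin (d + 1))) (hx : ‖x‖ = 1) (hu : ‖u‖ = 1)
    (hxu : inner ℝ x u = 0) (φ : ℝ) :
    ∫ y, q.eval (Real.cos φ * inner ℝ x y + Real.sin φ * inner ℝ u y) *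
      (Real.sin φ * inner ℝ x y - Real.cos φ * inner ℝ u y) ∂(sphereMeasure d) =
    ∫ y, q.eval (inner ℝ x y) * inner ℝ u y ∂(sphereMeasure d) := by
  set v := Real.cos (φ / 2) • x + Real.sin (φ / 2) • u with hv
  have hvn : ‖v‖ ^ 2 = 1 := by
    rw [← real_inner_self_eq_norm_sq, hv]
    simp only [inner_add_left, inner_add_right, inner_smul_left, inner_smul_right,
      real_inner_self_eq_norm_sq, hx, hu, hxu, real_inner_comm x u]
    simp
    nlinarith [Real.sin_sq_add_cos_sq (φ / 2)]
  set e := (ℝ ∙ v).reflection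
  have := (sphere_mp e).integral_comp e.toHomeomorph.measurableEmbedding
    (fun y => q.eval (inner ℝ x y) * inner ℝ u y)
  rw [← this]
  have hc : Real.cos φ = 2 * Real.cos (φ / 2) ^ 2 - 1 := by
    rw [← Real.cos_two_mul]; congr 1; ring
  have hc2 := Real.sin_sq_add_cos_sq (φ / 2)
  have hs : Real.sin φ = 2 * Real.sin (φ / 2) * Real.cos (φ / 2) := by
    rw [← Real.sin_two_mul]; congr 1; ring
  have he : ∀ y, e y = (2 * inner ℝ v y) • v - y := by
    intro y
    have h := Submodule.reflection_singleton_apply (𝕜 := ℝ) v y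
    simp only [RCLike.ofReal_real_eq_id, id, hvn, div_one] at h
    rw [show e y = _ from h, ← smul_assoc]; simp
  have hvx : inner ℝ x v = Real.cos (φ / 2) := by
    rw [hv, inner_add_right, inner_smul_right, inner_smul_right, hxu, real_inner_self_eq_norm_sq, hx]
    simp
  have hvu : inner ℝ u v = Real.sin (φ / 2) := by
    rw [hv, inner_add_right, inner_smul_right, inner_smul_right, real_inner_comm, hxu,
      real_inner_self_eq_norm_sq, hu]
    simp
  refine integral_congr_ae (Filter.Eventually.of_forall fun y => ?_)
  have h0 : inner ℝ v y = Real.cos (φ / 2) * inner ℝ x y + Real.sin (φ / 2) * inner ℝ u y := by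
    rw [hv, inner_add_left, inner_smul_left, inner_smul_left]; simp
  have h1 : inner ℝ x (e y) = Real.cos φ * inner ℝ x y + Real.sin φ * inner ℝ u y := by
    rw [he, inner_sub_right, inner_smul_right, hvx, h0, hc, hs]; ring
  have h2 : inner ℝ u (e y) = Real.sin φ * inner ℝ x y - Real.cos φ * inner ℝ u y := by
    rw [he, inner_sub_right, inner_smul_right, hvu, h0, hc, hs]
    linear_combination 2 * inner ℝ u y * hc2
  simp only [h1, h2]

open Polynomial in
lemma rot_deriv (q : ℝ[X]) (x u : EuclideanSpace ℝ (Fin (d + 1))) (hx : ‖x‖ = 1) (hu : ‖u‖ = 1)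
    (hxu : inner ℝ x u = 0) :
    ∫ y, (q.eval (inner ℝ x y) * inner ℝ x y - q.derivative.eval (inner ℝ x y) * inner ℝ u y ^ 2)
      ∂(sphereMeasure d) = 0 := by
  obtain ⟨M₁, hM₁⟩ := (isCompact_Icc (a := (-2 : ℝ)) (b := 2)).exists_bound_of_continuousOn
    q.continuous.continuousOn
  obtain ⟨M₂, hM₂⟩ := (isCompact_Icc (a := (-2 : ℝ)) (b := 2)).exists_bound_of_continuousOn
    q.derivative.continuous.continuousOn
  let F : ℝ → EuclideanSpace ℝ (Fin (d + 1)) → ℝ := fun φ y =>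
    q.eval (Real.cos φ * inner ℝ x y + Real.sin φ * inner ℝ u y) *
      (Real.sin φ * inner ℝ x y - Real.cos φ * inner ℝ u y)
  let F' : ℝ → EuclideanSpace ℝ (Fin (d + 1)) → ℝ := fun φ y =>
    q.derivative.eval (Real.cos φ * inner ℝ x y + Real.sin φ * inner ℝ u y) *
      (-Real.sin φ * inner ℝ x y + Real.cos φ * inner ℝ u y) *
      (Real.sin φ * inner ℝ x y - Real.cos φ * inner ℝ u y) +
    q.eval (Real.cos φ * inner ℝ x y + Real.sin φ * inner ℝ u y) *
      (Real.cos φ * inner ℝ x y + Real.sin φ * inner ℝ u y)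
  have hcF : ∀ φ, Continuous (F φ) := by
    intro φ
    have := q.continuous
    fun_prop
  have hcF' : ∀ φ, Continuous (F' φ) := by
    intro φ
    have := q.continuous
    have := q.derivative.continuous
    fun_prop
  have habs : ∀ a b s w : ℝ, |a| ≤ 1 → |b| ≤ 1 → |s| ≤ 1 → |w| ≤ 1 → |a * s + b * w| ≤ 2 := by
    intro a b s w ha hb hs hw
    calc |a * s + b * w| ≤ |a * s| + |b * w| := abs_add_le _ _
      _ = |a| * |s| + |b| * |w| := by rw [abs_mul, abs_mul]
      _ ≤ 1 * 1 + 1 * 1 := by gcongr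
      _ = 2 := by norm_num
  have hmain := hasDerivAt_integral_of_dominated_loc_of_deriv_le (μ := sphereMeasure d) (F := F)
    (F' := F') (x₀ := 0) (s := Set.univ) (bound := fun _ => M₂ * 2 * 2 + M₁ * 2) Filter.univ_mem
    (Filter.Eventually.of_forall fun φ => (hcF φ).aestronglyMeasurable) (sphere_int (hcF 0))
    (hcF' 0).aestronglyMeasurable
    (by
      filter_upwards [ae_sphere] with y hy φ _
      have hs : |inner ℝ x y| ≤ 1 := by
        have := abs_real_inner_le_norm x y
        rwa [hx, hy, one_mul] at this
      have hw : |inner ℝ u y| ≤ 1 := by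
        have := abs_real_inner_le_norm u y
        rwa [hu, hy, one_mul] at this
      have hc := Real.abs_cos_le_one φ
      have hn := Real.abs_sin_le_one φ
      have h1 := habs _ _ _ _ hc hn hs hw
      have h2 := habs (-Real.sin φ) _ _ _ (by rwa [abs_neg]) hc hs hw
      have h3 : |Real.sin φ * inner ℝ x y - Real.cos φ * inner ℝ u y| ≤ 2 := by
        have := habs (Real.sin φ) (-Real.cos φ) _ _ hn (by rwa [abs_neg]) hs hw
        rwa [neg_mul, ← sub_eq_add_neg] at this
      have h4 := hM₁ _ (abs_le.1 h1)
      have h5 := hM₂ _ (abs_le.1 h1)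
      have hM₂0 := (norm_nonneg _).trans h5
      have hM₁0 := (norm_nonneg _).trans h4
      refine (norm_add_le _ _).trans ?_
      rw [norm_mul, norm_mul, norm_mul]
      rw [← Real.norm_eq_abs] at h1 h2 h3
      gcongr)
    (integrable_const _)
    (by
      refine Filter.Eventually.of_forall fun y φ _ => ?_
      have hA : HasDerivAt (fun φ => Real.cos φ * inner ℝ x y + Real.sin φ * inner ℝ u y)
          (-Real.sin φ * inner ℝ x y + Real.cos φ * inner ℝ u y) φ :=
        ((Real.hasDerivAt_cos φ).mul_const _).add ((Real.hasDerivAt_sin φ).mul_const _)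
      have hB : HasDerivAt (fun φ => Real.sin φ * inner ℝ x y - Real.cos φ * inner ℝ u y)
          (Real.cos φ * inner ℝ x y - -Real.sin φ * inner ℝ u y) φ :=
        ((Real.hasDerivAt_sin φ).mul_const _).sub ((Real.hasDerivAt_cos φ).mul_const _)
      have := ((q.hasDerivAt _).comp φ hA).mul hB
      refine this.congr_deriv ?_
      simp only [F', Function.comp]
      ring)
  have hconst : (fun φ => ∫ y, F φ y ∂(sphereMeasure d)) =
      fun _ => ∫ y, q.eval (inner ℝ x y) * inner ℝ u y ∂(sphereMeasure d) :=
    funext fun φ => rot_inv q x u hx hu hxu φ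
  have h := hmain.2
  rw [hconst] at h
  have h0 := h.unique (hasDerivAt_const _ _)
  rw [← h0]
  refine integral_congr_ae (Filter.Eventually.of_forall fun y => ?_)
  simp [F']
  ring

open Polynomial in
lemma moment (q : ℝ[X]) (x : EuclideanSpace ℝ (Fin (d + 1))) (hx : ‖x‖ = 1) :
    ∫ y, ((1 - inner ℝ x y ^ 2) * q.derivative.eval (inner ℝ x y) -
      d * inner ℝ x y * q.eval (inner ℝ x y)) ∂(sphereMeasure d) = 0 := by
  obtain ⟨b, hb⟩ := Orthonormal.exists_orthonormalBasis_extension_of_card_eq (𝕜 := ℝ)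
    (E := EuclideanSpace ℝ (Fin (d + 1))) (ι := Fin (d + 1)) (by simp) (v := fun _ => x) (s := {0})
    (by
      constructor
      · intro i; exact hx
      · intro i j hij; exact absurd (Subsingleton.elim i j) hij)
  have hb0 : b 0 = x := hb 0 rfl
  have hsum : ∑ k : Fin d, ∫ y, (q.eval (inner ℝ x y) * inner ℝ x y -
      q.derivative.eval (inner ℝ x y) * inner ℝ (b k.succ) y ^ 2) ∂(sphereMeasure d) = 0 := by
    refine Finset.sum_eq_zero fun k _ => rot_deriv q x _ hx (b.orthonormal.1 _) ?_
    rw [← hb0]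
    exact b.orthonormal.2 (Fin.succ_ne_zero k).symm
  have h1 := q.continuous
  have h2 := q.derivative.continuous
  rw [← integral_finset_sum _ (fun k _ => sphere_int (by fun_prop))] at hsum
  rw [← neg_eq_zero, ← integral_neg, ← hsum]
  refine integral_congr_ae ?_
  filter_upwards [ae_sphere] with y hy
  have hs := b.sum_sq_inner_right y
  rw [hy, Fin.sum_univ_succ, hb0] at hs
  rw [Finset.sum_sub_distrib, ← Finset.mul_sum Finset.univ (fun k : Fin d => inner ℝ (b k.succ) y ^ 2)]
  simp only [Finset.sum_const, Finset.card_univ, Fintype.card_fin, nsmul_eq_mul]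
  linear_combination ((q.derivative.eval (inner ℝ x y))) * hs

lemma legendre_integral (hd : 2 ≤ d) (n : ℕ) (hn : 1 ≤ n) (x : EuclideanSpace ℝ (Fin (d + 1)))
    (hx : ‖x‖ = 1) : ∫ y, legendreP d n (inner ℝ x y) ∂(sphereMeasure d) = 0 := by
  have h := moment (Polynomial.derivative (PP d n)) x hx
  have ho := (PP_ode d hd n).1
  have hc : -((n : ℝ) * (n + d - 1)) ≠ 0 := by
    have h1 : (1:ℝ) ≤ n := by exact_mod_cast hn
    have h2 : (2:ℝ) ≤ d := by exact_mod_cast hd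
    have : 0 < (n : ℝ) * (n + d - 1) := by apply mul_pos <;> linarith
    linarith
  have : ∫ y, -((n : ℝ) * (n + d - 1)) * legendreP d n (inner ℝ x y) ∂(sphereMeasure d) = 0 := by
    rw [← h]
    refine integral_congr_ae (Filter.Eventually.of_forall fun y => ?_)
    have := congrArg (Polynomial.eval (inner ℝ x y)) ho
    simp [PP_eval] at this
    simp only
    linear_combination -this
  rw [integral_const_mul] at this
  exact (mul_eq_zero.1 this).resolve_left hc

end hausdorff

end SphDes

/-- Linear programming (Delsarte) bound.  If `f : [-1,1] → ℝ` is continuous and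
positive with Legendre expansion `f(x) = Σ_n f̂(n) Z(d,n) P_n^{(d)}(x)` converging absolutely
and uniformly on `[-1,1]`, `f̂(0) > 0` and `f̂(n) ≤ 0` for `n > t`, then every spherical
`t`-design with `N` points on `S^d` satisfies `N ≥ f(1)/f̂(0)`. -/
theorem linear_programming_lower_bound_for_designs
    (d t N : ℕ) (hd : 2 ≤ d)
    (f : ℝ → ℝ) (fhat : ℕ → ℝ)
    (hfcont : ContinuousOn f (Set.Icc (-1 : ℝ) 1))
    (hfpos : ∀ x ∈ Set.Icc (-1 : ℝ) 1, 0 < f x)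
    (hexp : ∀ x ∈ Set.Icc (-1 : ℝ) 1,
      HasSum (fun n => fhat n * Zdim d n * legendreP d n x) (f x))
    (habs : ∀ x ∈ Set.Icc (-1 : ℝ) 1,
      Summable (fun n => |fhat n * Zdim d n * legendreP d n x|))
    (hunif : TendstoUniformlyOn
      (fun m x => ∑ n ∈ Finset.range m, fhat n * Zdim d n * legendreP d n x) f
      atTop (Set.Icc (-1 : ℝ) 1))
    (hf0 : 0 < fhat 0) (hfneg : ∀ n : ℕ, t < n → fhat n ≤ 0)
    (X : Finset (EuclideanSpace ℝ (Fin (d + 1)))) (hcard : X.card = N)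
    (hXsphere : ∀ x ∈ X, ‖x‖ = 1)
    (hdesign : IsSphericalDesign d t X) :
    f 1 / fhat 0 ≤ (N : ℝ) := by
  have hsq : ∀ x ∈ X, ∑ i, x i ^ 2 = 1 := by
    intro x hx
    have := hXsphere x hx
    rwa [EuclideanSpace.norm_eq, Real.sqrt_eq_one, Finset.sum_congr rfl (fun i _ => by
      rw [Real.norm_eq_abs, sq_abs])] at this
  have hNpos : 0 < N := by
    rcases Nat.eq_zero_or_pos N with h | h
    · exfalso
      have hX : X = ∅ := Finset.card_eq_zero.1 (hcard.trans h)
      have := hdesign 1 (by simp)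
      simp [hX] at this
    · exact h
  have hZ0 : Zdim d 0 = 1 := by
    have h2 : (2:ℝ) ≤ d := by exact_mod_cast hd
    have : ((d : ℝ) - 1) ≠ 0 := by linarith
    simp [Zdim, this]
  have hZ : ∀ n, 0 ≤ Zdim d n := by
    intro n
    have h2 : (2:ℝ) ≤ d := by exact_mod_cast hd
    have h3 : (0:ℝ) ≤ n := Nat.cast_nonneg n
    exact mul_nonneg (div_nonneg (by linarith) (by linarith)) (Nat.cast_nonneg _)
  have hmem : ∀ x ∈ X, ∀ y ∈ X, (inner ℝ x y : ℝ) ∈ Set.Icc (-1 : ℝ) 1 := by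
    intro x hx y hy
    have := abs_real_inner_le_norm x y
    rw [hXsphere x hx, hXsphere y hy, one_mul] at this
    exact abs_le.1 this
  -- the double sum of the Legendre polynomials
  let S : ℕ → ℝ := fun n => ∑ x ∈ X, ∑ y ∈ X, legendreP d n (inner ℝ x y)
  have hSeq : ∀ n, S n = ∑ x ∈ X, ∑ y ∈ X,
      MvPolynomial.eval (fun i => y i) (SphDes.HP d (fun i => x i) n) := fun n =>
    Finset.sum_congr rfl fun x _ => Finset.sum_congr rfl fun y hy =>
      (SphDes.eval_HP d x y (hsq y hy) n).symm
  have hSnonneg : ∀ n, 0 ≤ S n := fun n => by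
    rw [hSeq]; exact SphDes.HP_psd d (by omega) n X hsq
  have hSzero : ∀ n, 1 ≤ n → n ≤ t → S n = 0 := by
    intro n hn hnt
    rw [hSeq]
    refine Finset.sum_eq_zero fun x hx => ?_
    have h1 := hdesign (SphDes.HP d (fun i => x i) n)
      ((SphDes.HP_hom d (fun i => x i) n).totalDegree_le.trans hnt)
    have h2 : ∫ y, MvPolynomial.eval (fun i => y i) (SphDes.HP d (fun i => x i) n)
        ∂(sphereMeasure d) = 0 := by
      rw [← SphDes.legendre_integral hd n hn x (hXsphere x hx)]
      refine integral_congr_ae ?_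
      filter_upwards [SphDes.ae_sphere] with y hy
      refine SphDes.eval_HP d x y ?_ n
      rwa [EuclideanSpace.norm_eq, Real.sqrt_eq_one, Finset.sum_congr rfl (fun i _ => by
        rw [Real.norm_eq_abs, sq_abs])] at hy
    rw [h2] at h1
    refine (mul_eq_zero.1 h1).resolve_left ?_
    rw [hcard]
    positivity
  have hS0 : S 0 = (N : ℝ) * N := by
    simp [S, legendreP, hcard]
  have hsum : HasSum (fun n => fhat n * Zdim d n * S n) (∑ x ∈ X, ∑ y ∈ X, f (inner ℝ x y)) := by
    have := hasSum_sum (s := X) fun x hx => hasSum_sum (s := X) fun y hy =>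
      hexp (inner ℝ x y) (hmem x hx y hy)
    simpa only [S, Finset.mul_sum] using this
  have hle : ∑ x ∈ X, ∑ y ∈ X, f (inner ℝ x y) ≤ fhat 0 * ((N : ℝ) * N) := by
    refine hasSum_le (fun n => ?_) hsum (hasSum_ite_eq 0 (fhat 0 * ((N : ℝ) * N)))
    split_ifs with h
    · rw [h, hZ0, hS0, mul_one]
    · rcases le_or_gt n t with hnt | hnt
      · rw [hSzero n (Nat.one_le_iff_ne_zero.2 h) hnt, mul_zero]
      · exact mul_nonpos_of_nonpos_of_nonneg
          (mul_nonpos_of_nonpos_of_nonneg (hfneg n hnt) (hZ n)) (hSnonneg n)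
  have hge : (N : ℝ) * f 1 ≤ ∑ x ∈ X, ∑ y ∈ X, f (inner ℝ x y) := by
    rw [← hcard, ← nsmul_eq_mul, ← Finset.sum_const]
    refine Finset.sum_le_sum fun x hx => ?_
    have h1 : f 1 = f (inner ℝ x x) := by
      rw [real_inner_self_eq_norm_sq, hXsphere x hx, one_pow]
    rw [h1]
    exact Finset.single_le_sum (f := fun y => f (inner ℝ x y))
      (fun y hy => (hfpos _ (hmem x hx y hy)).le) hx
  have hN : (0 : ℝ) < N := by exact_mod_cast hNpos
  rw [div_le_iff₀ hf0]
  have := hge.trans hle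
  have h3 : (N : ℝ) * f 1 ≤ N * (N * fhat 0) := by linarith
  exact le_of_mul_le_mul_left h3 hN
end

section
/- Every spherical t-design X_N on S^d with N points satisfies the Delsarte–Goethals–Seidel bound: N ≥ binom(d + t/2, d) + binom(d + t/2 - 1, d) when t is even, and N ≥ 2·binom(d + (t-1)/2, d) when t is odd. -/
open MeasureTheory

open Module

theorem dgs_fin (d : ℕ) : μH[(d : ℝ)] (Metric.sphere (0 : EuclideanSpace ℝ (Fin (d + 1))) 1) < ⊤ := by
  have : Fact (finrank ℝ (EuclideanSpace ℝ (Fin (d + 1))) = d + 1) := ⟨by simp⟩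
  refine (isCompact_sphere _ _).measure_lt_top_of_nhdsWithin fun x hx => ?_
  have hx1 : ‖x‖ = 1 := by simpa using hx
  have hv : ‖-x‖ = 1 := by simpa using hx1
  have hv0 : -x ≠ 0 := by intro h; simp [h] at hv
  have hfr := Submodule.finrank_orthogonal_span_singleton (𝕜 := ℝ) (n := d) hv0
  set v := -x with hvdef
  let f : (ℝ ∙ v)ᗮ → EuclideanSpace ℝ (Fin (d + 1)) := fun w => stereoInvFunAux v w
  have hf : ContDiff ℝ 1 f := contDiff_stereoInvFunAux.comp (ℝ ∙ v)ᗮ.subtypeL.contDiff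
  obtain ⟨K, hK⟩ := hf.contDiffOn.exists_lipschitzOnWith one_ne_zero
    (convex_closedBall (0 : (ℝ ∙ v)ᗮ) 1) (isCompact_closedBall _ _)
  refine ⟨f '' Metric.closedBall 0 1, ?_, ?_⟩
  · have hin : innerSL ℝ v x ≠ (1 : ℝ) := by
      simp [hvdef, hx1]; norm_num
    have hc : ContinuousAt (stereoToFun v) x := by
      refine continuousOn_stereoToFun.continuousAt (IsOpen.mem_nhds ?_ hin)
      exact isOpen_ne.preimage (innerSL ℝ v).continuous
    have h0 : stereoToFun v x = 0 := by
      rw [stereoToFun_apply]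
      have : (ℝ ∙ v)ᗮ.orthogonalProjectionOnto x = 0 := by
        rw [Submodule.orthogonalProjectionOnto_eq_zero_iff]
        rw [Submodule.orthogonal_orthogonal]
        exact Submodule.mem_span_singleton.2 ⟨-1, by simp [hvdef]⟩
      rw [this, smul_zero]
    have h1 : stereoToFun v ⁻¹' Metric.closedBall 0 1 ∈ nhds x :=
      hc (by rw [h0]; exact Metric.closedBall_mem_nhds _ one_pos)
    have h2 : {y | y ≠ v} ∈ nhds x := isOpen_ne.mem_nhds (by
      rintro h; apply hin; rw [h]; simp [hv])
    filter_upwards [mem_nhdsWithin_of_mem_nhds h1, mem_nhdsWithin_of_mem_nhds h2,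
      self_mem_nhdsWithin] with y hy1 hy2 hy3
    refine ⟨stereoToFun v y, hy1, ?_⟩
    have := stereo_left_inv hv (x := ⟨y, hy3⟩) hy2
    exact congrArg Subtype.val this
  · refine (hK.hausdorffMeasure_image_le (Nat.cast_nonneg d)).trans_lt ?_
    refine ENNReal.mul_lt_top (by finiteness) ?_
    have hμ : (μH[(d : ℝ)] : Measure (ℝ ∙ v)ᗮ) = μH[(finrank ℝ (ℝ ∙ v)ᗮ : ℝ)] := by rw [hfr]
    rw [hμ]
    exact (isCompact_closedBall _ _).measure_lt_top

theorem dgs_pos (d : ℕ) (U : Set (EuclideanSpace ℝ (Fin (d + 1)))) (hU : IsOpen U)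
    (x : EuclideanSpace ℝ (Fin (d + 1))) (hx1 : ‖x‖ = 1) (hxU : x ∈ U) :
    0 < μH[(d : ℝ)] (U ∩ Metric.sphere (0 : EuclideanSpace ℝ (Fin (d + 1))) 1) := by
  have : Fact (finrank ℝ (EuclideanSpace ℝ (Fin (d + 1))) = d + 1) := ⟨by simp⟩
  have hv0 : x ≠ 0 := by intro h; simp [h] at hx1
  have hfr := Submodule.finrank_orthogonal_span_singleton (𝕜 := ℝ) (n := d) hv0
  let P := (ℝ ∙ x)ᗮ.orthogonalProjectionOnto
  have hP : LipschitzWith 1 P := Submodule.lipschitzWith_orthogonalProjectionOnto _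
  let g : (ℝ ∙ x)ᗮ → EuclideanSpace ℝ (Fin (d + 1)) := fun w => Real.sqrt (1 - ‖w‖ ^ 2) • x + w
  have hg : Continuous g := by fun_prop
  let V := g ⁻¹' U ∩ Metric.ball 0 1
  have hV : IsOpen V := (hU.preimage hg).inter Metric.isOpen_ball
  have hVne : V.Nonempty := ⟨0, by simp [V, g, hxU]⟩
  have hsub : V ⊆ P '' (U ∩ Metric.sphere 0 1) := by
    rintro w ⟨hw1, hw2⟩
    refine ⟨g w, ⟨hw1, ?_⟩, ?_⟩
    · have hwn : ‖w‖ < 1 := by simpa using hw2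
      have hin : inner ℝ (Real.sqrt (1 - ‖w‖ ^ 2) • x) (w : EuclideanSpace ℝ (Fin (d + 1))) = 0 := by
        rw [inner_smul_left, Submodule.mem_orthogonal_singleton_iff_inner_right.1 w.2, mul_zero]
      have := norm_add_sq_eq_norm_sq_add_norm_sq_of_inner_eq_zero _ _ hin
      have hnn : 0 ≤ 1 - ‖w‖ ^ 2 := by nlinarith [norm_nonneg w]
      rw [norm_smul, hx1, mul_one, Real.norm_eq_abs, abs_mul_abs_self, Real.mul_self_sqrt hnn] at this
      have h2 : ‖g w‖ * ‖g w‖ = 1 := by rw [this, Submodule.coe_norm]; ring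
      have : ‖g w‖ = 1 := by nlinarith [norm_nonneg (g w)]
      simpa using this
    · have hPx : P x = 0 := by
        rw [Submodule.orthogonalProjectionOnto_eq_zero_iff, Submodule.orthogonal_orthogonal]
        exact Submodule.mem_span_singleton_self x
      simp only [g, map_add, map_smul, hPx, smul_zero, zero_add]
      exact Submodule.orthogonalProjectionOnto_mem_subspace_eq_self w
  have h1 : 0 < μH[(d : ℝ)] V := by
    have hμ : (μH[(d : ℝ)] : Measure (ℝ ∙ x)ᗮ) = μH[(finrank ℝ (ℝ ∙ x)ᗮ : ℝ)] := by rw [hfr]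
    rw [hμ]
    exact hV.measure_pos _ hVne
  have h2 := hP.hausdorffMeasure_image_le (Nat.cast_nonneg d) (U ∩ Metric.sphere 0 1)
  simp only [ENNReal.coe_one, ENNReal.one_rpow, one_mul] at h2
  exact h1.trans_le ((measure_mono hsub).trans h2)

theorem dgs_cont {d : ℕ} (p : MvPolynomial (Fin (d + 1)) ℝ) :
    Continuous fun y : EuclideanSpace ℝ (Fin (d + 1)) => MvPolynomial.eval (fun i => y i) p :=
  p.continuous_eval.comp (by fun_prop)

theorem dgs_sq_zero (d : ℕ) (p : MvPolynomial (Fin (d + 1)) ℝ)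
    (h : ∫ y, MvPolynomial.eval (fun i => y i) (p * p) ∂(sphereMeasure d) = 0)
    (x : EuclideanSpace ℝ (Fin (d + 1))) (hx : ‖x‖ = 1) :
    MvPolynomial.eval (fun i => x i) p = 0 := by
  set S := Metric.sphere (0 : EuclideanSpace ℝ (Fin (d + 1))) 1 with hS
  have hfin := dgs_fin d
  have hpos : 0 < μH[(d : ℝ)] S := by
    simpa using dgs_pos d Set.univ isOpen_univ x hx trivial
  rw [sphereMeasure, integral_smul_measure, smul_eq_mul, mul_eq_zero] at h
  have h' := h.resolve_left (by
    exact ENNReal.toReal_ne_zero.2 ⟨ENNReal.inv_ne_zero.2 hfin.ne, ENNReal.inv_ne_top.2 hpos.ne'⟩)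
  have : IsFiniteMeasure ((μH[(d : ℝ)]).restrict S) := ⟨by simpa using hfin⟩
  have hint : IntegrableOn (fun y : EuclideanSpace ℝ (Fin (d + 1)) =>
      MvPolynomial.eval (fun i => y i) (p * p)) S μH[(d : ℝ)] :=
    (dgs_cont (p * p)).continuousOn.integrableOn_of_subset_isCompact (isCompact_sphere _ _)
      Metric.isClosed_sphere.measurableSet subset_rfl hfin.ne
  rw [setIntegral_eq_zero_iff_of_nonneg_ae (Filter.Eventually.of_forall fun y => by
    simpa using mul_self_nonneg _) hint] at h'
  by_contra hne
  have hU : IsOpen {y : EuclideanSpace ℝ (Fin (d + 1)) | MvPolynomial.eval (fun i => y i) p ≠ 0} :=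
    isOpen_ne.preimage (dgs_cont p)
  have hp := dgs_pos d _ hU x hx hne
  rw [Filter.EventuallyEq, ae_iff, Measure.restrict_apply' Metric.isClosed_sphere.measurableSet] at h'
  apply hp.ne'
  simpa using h'

theorem dgs_odd (d : ℕ) (f : EuclideanSpace ℝ (Fin (d + 1)) → ℝ) (hf : ∀ y, f (-y) = - f y) :
    ∫ y, f y ∂(sphereMeasure d) = 0 := by
  have hmp := (IsometryEquiv.neg (EuclideanSpace ℝ (Fin (d + 1)))).measurePreserving_hausdorffMeasure d
  have h1 := hmp.setIntegral_preimage_emb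
    (IsometryEquiv.neg (EuclideanSpace ℝ (Fin (d + 1)))).toHomeomorph.measurableEmbedding f
    (Metric.sphere 0 1)
  have hpre : (IsometryEquiv.neg (EuclideanSpace ℝ (Fin (d + 1)))) ⁻¹' (Metric.sphere 0 1)
      = Metric.sphere 0 1 := by
    ext y; simp
  rw [hpre] at h1
  simp only [IsometryEquiv.neg_apply, hf, integral_neg] at h1
  rw [sphereMeasure, integral_smul_measure]
  have : ∫ y in Metric.sphere 0 1, f y ∂μH[(d : ℝ)] = 0 := by linarith
  rw [this, smul_zero]

theorem dgs_hom_smul {σ : Type*} {p : MvPolynomial σ ℝ} {n : ℕ} (hp : p.IsHomogeneous n)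
    (c : ℝ) (x : σ → ℝ) :
    MvPolynomial.eval (fun i => c * x i) p = c ^ n * MvPolynomial.eval x p := by
  rw [MvPolynomial.eval_eq, MvPolynomial.eval_eq, Finset.mul_sum]
  refine Finset.sum_congr rfl fun m hm => ?_
  have := hp (MvPolynomial.mem_support_iff.1 hm)
  simp only [mul_pow, Finset.prod_mul_distrib, Finset.prod_pow_eq_pow_sum]
  have h2 : ∑ i ∈ m.support, m i = n := by
    rw [← this, Finsupp.weight_apply, Finsupp.sum]; simp
  rw [h2]; ring

theorem dgs_hom_zero {d n : ℕ} {p : MvPolynomial (Fin (d + 1)) ℝ} (hp : p.IsHomogeneous n)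
    (h : ∀ x : EuclideanSpace ℝ (Fin (d + 1)), ‖x‖ = 1 → MvPolynomial.eval (fun i => x i) p = 0) :
    p = 0 := by
  refine hp.eq_zero_of_forall_eval_eq_zero fun r => ?_
  obtain ⟨c, u, hu, hr⟩ : ∃ (c : ℝ) (u : EuclideanSpace ℝ (Fin (d + 1))), ‖u‖ = 1 ∧
      WithLp.toLp 2 r = c • u := by
    by_cases h0 : WithLp.toLp 2 r = 0
    · exact ⟨0, EuclideanSpace.single 0 1, by simp, by simp [h0]⟩
    · exact ⟨‖WithLp.toLp 2 r‖, ‖WithLp.toLp 2 r‖⁻¹ • WithLp.toLp 2 r, norm_smul_inv_norm h0, by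
        rw [smul_smul, mul_inv_cancel₀ (norm_ne_zero_iff.2 h0), one_smul]⟩
  have : r = fun i => c * u i := by
    funext i
    exact congrArg (fun z : EuclideanSpace ℝ (Fin (d + 1)) => z i) hr
  rw [this, dgs_hom_smul hp, h u hu, mul_zero]

instance dgs_finite (d n : ℕ) : Module.Finite ℝ (MvPolynomial.homogeneousSubmodule (Fin (d + 1)) ℝ n) :=
  Module.Finite.iff_fg.2 (MvPolynomial.homogeneousSubmodule_fg _ _ n)

theorem dgs_dim (d n : ℕ) : (d + n).choose d ≤
    finrank ℝ (MvPolynomial.homogeneousSubmodule (Fin (d + 1)) ℝ n) := by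
  let b : (Finset.univ : Finset (Fin (d + 1))).finsuppAntidiag n →
      MvPolynomial.homogeneousSubmodule (Fin (d + 1)) ℝ n := fun m =>
    ⟨MvPolynomial.monomial m.1 1, MvPolynomial.isHomogeneous_monomial _ (by
      have := (Finset.mem_finsuppAntidiag.1 m.2).1
      rw [Finsupp.degree_eq_sum]; exact this)⟩
  have hb : LinearIndependent ℝ b := by
    refine LinearIndependent.of_comp (Submodule.subtype _) ?_
    have := (MvPolynomial.basisMonomials (Fin (d + 1)) ℝ).linearIndependent.comp
      (fun m : (Finset.univ : Finset (Fin (d + 1))).finsuppAntidiag n => m.1) Subtype.val_injective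
    have hbe : (Submodule.subtype _ ∘ b) = ((MvPolynomial.basisMonomials (Fin (d + 1)) ℝ) ∘
        fun m : (Finset.univ : Finset (Fin (d + 1))).finsuppAntidiag n => m.1) := by
      funext m
      simp [b]
    rw [hbe]
    exact this
  have := hb.fintype_card_le_finrank
  rw [Fintype.card_coe, Finset.card_finsuppAntidiag_nat_eq_choose] at this
  convert this using 1
  rw [Finset.card_univ, Fintype.card_fin, show d + 1 + n - 1 = d + n by omega]
  exact Nat.choose_symm_add 

/-- Restriction of polynomials to the point set. -/
noncomputable def dgsR {d : ℕ} (X : Finset (EuclideanSpace ℝ (Fin (d + 1)))) :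
    MvPolynomial (Fin (d + 1)) ℝ →ₗ[ℝ] (X → ℝ) :=
  LinearMap.pi fun x => (MvPolynomial.aeval (fun i => x.1 i)).toLinearMap

theorem dgsR_apply {d : ℕ} (X : Finset (EuclideanSpace ℝ (Fin (d + 1))))
    (p : MvPolynomial (Fin (d + 1)) ℝ) (x : X) :
    dgsR X p x = MvPolynomial.eval (fun i => x.1 i) p := by
  simp [dgsR, MvPolynomial.aeval_eq_eval]

theorem dgs_vanish {d t : ℕ} {X : Finset (EuclideanSpace ℝ (Fin (d + 1)))}
    (hdesign : IsSphericalDesign d t X) (p : MvPolynomial (Fin (d + 1)) ℝ)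
    (hp : p.totalDegree + p.totalDegree ≤ t) (h0 : dgsR X p = 0)
    (x : EuclideanSpace ℝ (Fin (d + 1))) (hx : ‖x‖ = 1) :
    MvPolynomial.eval (fun i => x i) p = 0 := by
  refine dgs_sq_zero d p ?_ x hx
  rw [← hdesign (p * p) ((MvPolynomial.totalDegree_mul _ _).trans hp)]
  rw [Finset.sum_eq_zero, mul_zero]
  intro y hy
  have := congrFun h0 ⟨y, hy⟩
  rw [dgsR_apply] at this
  simpa using this

theorem dgs_even {d e : ℕ} {X : Finset (EuclideanSpace ℝ (Fin (d + 1)))} (hd : 1 ≤ d)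
    (hdesign : IsSphericalDesign d (e + e) X) :
    (d + e).choose d + (d + e - 1).choose d ≤ X.card := by
  have hcX : finrank ℝ (X → ℝ) = X.card := by simp
  rw [← hcX]
  rcases Nat.eq_zero_or_pos e with rfl | he
  · have hz : (d + 0 - 1).choose d = 0 := Nat.choose_eq_zero_of_lt (by omega)
    rw [hz, add_zero]
    refine (dgs_dim d 0).trans ?_
    refine LinearMap.finrank_le_finrank_of_injective (f := (dgsR X).comp (Submodule.subtype _)) ?_
    rw [← LinearMap.ker_eq_bot, LinearMap.ker_eq_bot']
    rintro ⟨f, hf⟩ h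
    have hf' : f.IsHomogeneous 0 := hf
    have := hf'.totalDegree_le
    ext1
    exact dgs_hom_zero hf' (dgs_vanish hdesign f (by omega) h)
  · obtain ⟨k, rfl⟩ : ∃ k, e = k + 1 := ⟨e - 1, by omega⟩
    have h1 := dgs_dim d (k + 1)
    have h2 := dgs_dim d k
    rw [show d + (k + 1) - 1 = d + k by omega]
    refine (add_le_add h1 h2).trans ?_
    rw [← finrank_prod]
    refine LinearMap.finrank_le_finrank_of_injective
      (f := (dgsR X).comp ((Submodule.subtype _).coprod (Submodule.subtype _))) ?_
    rw [← LinearMap.ker_eq_bot, LinearMap.ker_eq_bot']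
    rintro ⟨⟨f, hf⟩, ⟨g, hg⟩⟩ h
    have hf' : f.IsHomogeneous (k + 1) := hf
    have hg' : g.IsHomogeneous k := hg
    have h3 := hf'.totalDegree_le
    have h4 := hg'.totalDegree_le
    have h5 := MvPolynomial.totalDegree_add f g
    have h6 : (f + g).totalDegree ≤ k + 1 := h5.trans (max_le h3 (by omega))
    have key := dgs_vanish hdesign (f + g) (by omega) h
    have key2 : ∀ x : EuclideanSpace ℝ (Fin (d + 1)), ‖x‖ = 1 →
        MvPolynomial.eval (fun i => x i) f = 0 ∧ MvPolynomial.eval (fun i => x i) g = 0 := by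
      intro x hx
      have a1 := key x hx
      have a2 := key (-x) (by simpa using hx)
      have hneg : (fun i => (-x) i) = fun i => (-1 : ℝ) * x i := by funext i; simp
      rw [map_add] at a1
      rw [hneg, map_add, dgs_hom_smul hf', dgs_hom_smul hg', pow_succ] at a2
      have a3 : (-1 : ℝ) ^ k * (MvPolynomial.eval (fun i => x i) g
        - MvPolynomial.eval (fun i => x i) f) = 0 := by linarith
      have a4 := (mul_eq_zero.1 a3).resolve_left (pow_ne_zero _ (by norm_num))
      constructor <;> linarith
    have b1 := dgs_hom_zero hf' fun x hx => (key2 x hx).1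
    have b2 := dgs_hom_zero hg' fun x hx => (key2 x hx).2
    subst b1; subst b2; rfl

theorem dgs_oddcase {d e : ℕ} {X : Finset (EuclideanSpace ℝ (Fin (d + 1)))}
    (hX : ∀ x ∈ X, ‖x‖ = 1)
    (hdesign : IsSphericalDesign d (2 * e + 1) X) :
    2 * (d + e).choose d ≤ X.card := by
  have hcX : finrank ℝ (X → ℝ) = X.card := by simp
  obtain ⟨φ, hφ⟩ := Module.exists_dual_forall_apply_ne_zero (K := ℝ)
    (fun x : X => (fun i => x.1 i : Fin (d + 1) → ℝ)) (fun x h => by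
      have h0 : x.1 = 0 := by ext i; exact congrFun h i
      have := hX x.1 x.2
      simp [h0] at this)
  let l : MvPolynomial (Fin (d + 1)) ℝ :=
    ∑ i, MvPolynomial.C (φ (Pi.single i 1)) * MvPolynomial.X i
  have hl : l.IsHomogeneous 1 := by
    refine MvPolynomial.IsHomogeneous.sum _ _ _ fun i _ => ?_
    exact (MvPolynomial.isHomogeneous_X _ _).C_mul _
  have hlX : ∀ x : X, MvPolynomial.eval (fun i => x.1 i) l ≠ 0 := by
    intro x
    convert hφ x using 1
    rw [LinearMap.pi_apply_eq_sum_univ φ]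
    simp only [l, map_sum, map_mul, MvPolynomial.eval_C, MvPolynomial.eval_X, smul_eq_mul]
    refine Finset.sum_congr rfl fun i _ => ?_
    rw [mul_comm]
    congr 2
    funext j
    simp [Pi.single_apply, eq_comm]
  have hinj : ∀ f : MvPolynomial (Fin (d + 1)) ℝ, f.IsHomogeneous e → dgsR X f = 0 → f = 0 := by
    intro f hf h
    have := hf.totalDegree_le
    exact dgs_hom_zero hf (dgs_vanish hdesign f (by omega) h)
  have h1 := dgs_dim d e
  rw [← hcX, two_mul]
  refine (add_le_add h1 h1).trans ?_
  rw [← finrank_prod]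
  refine LinearMap.finrank_le_finrank_of_injective
    (f := (dgsR X).comp ((Submodule.subtype _).coprod
      ((LinearMap.mulLeft ℝ l).comp (Submodule.subtype _)))) ?_
  rw [← LinearMap.ker_eq_bot, LinearMap.ker_eq_bot']
  rintro ⟨⟨f, hf⟩, ⟨g, hg⟩⟩ h
  have hf' : f.IsHomogeneous e := hf
  have hg' : g.IsHomogeneous e := hg
  have h' : dgsR X (f + l * g) = 0 := h
  have hhom : (f * (l * g)).IsHomogeneous (2 * e + 1) := by
    convert hf'.mul (hl.mul hg') using 1; omega
  have hval : ∀ x : X, MvPolynomial.eval (fun i => x.1 i) f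
      + MvPolynomial.eval (fun i => x.1 i) l * MvPolynomial.eval (fun i => x.1 i) g = 0 := by
    intro x
    have := congrFun h' x
    rw [dgsR_apply] at this
    simpa using this
  have hs := hdesign _ hhom.totalDegree_le
  rw [dgs_odd d _ (fun y => by
    have hneg : (fun i => (-y) i) = fun i => (-1 : ℝ) * y i := by funext i; simp
    rw [hneg, dgs_hom_smul hhom, pow_succ, pow_mul]; simp)] at hs
  have hs2 : ∑ x ∈ X, MvPolynomial.eval (fun i => x i) (f * (l * g)) = 0 := by
    rcases mul_eq_zero.1 hs with h | h
    · have : X = ∅ := by simpa using h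
      simp [this]
    · exact h
  have hs3 : ∑ x ∈ X, (MvPolynomial.eval (fun i => x i) f) ^ 2 = 0 := by
    rw [← neg_eq_zero, ← hs2, ← Finset.sum_neg_distrib]
    refine Finset.sum_congr rfl fun x hx => ?_
    have := hval ⟨x, hx⟩
    simp only [map_mul] at this ⊢
    have h3 : MvPolynomial.eval (fun i => x i) l * MvPolynomial.eval (fun i => x i) g
      = - MvPolynomial.eval (fun i => x i) f := by linarith
    rw [h3]; ring
  rw [Finset.sum_eq_zero_iff_of_nonneg (fun _ _ => sq_nonneg _)] at hs3
  have hfX : ∀ x : X, MvPolynomial.eval (fun i => x.1 i) f = 0 := fun x => by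
    simpa using hs3 x.1 x.2
  have b1 : f = 0 := hinj f hf' (by funext x; rw [dgsR_apply]; exact hfX x)
  have b2 : g = 0 := hinj g hg' (by
    funext x
    rw [dgsR_apply]
    have := hval x
    rw [hfX x, zero_add] at this
    exact (mul_eq_zero.1 this).resolve_left (hlX x))
  subst b1; subst b2; rfl

/-- Delsarte–Goethals–Seidel bound: every spherical `t`-design with `N` points
on `S^d` satisfies `N ≥ binom(d+t/2, d) + binom(d+t/2-1, d)` for `t` even and
`N ≥ 2 binom(d+(t-1)/2, d)` for `t` odd. -/
theorem delsarte_goethals_seidel_bound (d t N : ℕ) (hd : 1 ≤ d)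
    (X : Finset (EuclideanSpace ℝ (Fin (d + 1)))) (hcard : X.card = N)
    (hXsphere : ∀ x ∈ X, ‖x‖ = 1)
    (hdesign : IsSphericalDesign d t X) :
    (if Even t then Nat.choose (d + t / 2) d + Nat.choose (d + t / 2 - 1) d
     else 2 * Nat.choose (d + (t - 1) / 2) d) ≤ N := by
  subst hcard
  split_ifs with ht
  · obtain ⟨e, rfl⟩ := ht
    rw [show (e + e) / 2 = e by omega]
    exact dgs_even hd hdesign
  · obtain ⟨e, rfl⟩ := Nat.not_even_iff_odd.1 ht
    rw [show (2 * e + 1 - 1) / 2 = e by omega]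
    exact dgs_oddcase hXsphere hdesign
end
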